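/- arXiv:2002.09185 — 5 statements merged into one kernel-verified Lean document; each statement's English description precedes it below -/
import Mathlib

section
/- Fix b > 0, T > 0, H > 0, a boundary influx h ∈ C([0,T]) with h > 0 on [0,T], and an initial state u₀ ∈ C([0,b]) with 0 ≤ u₀(x) ≤ H(b−x) on [0,b]; set M = max(sup_{[0,T]} h, H). If (s, u) is a classical solution of the one-phase Stefan problem with data (b, u₀, h) on [0,T], then b ≤ s(t) ≤ T·sup_{[0,T]} h + b(sup_{[0,b]} u₀ + 1) for all t ∈ (0,T], and consequently ‖s‖_{W^{1,∞}} ≤ max(T·sup_{[0,T]} h + b(sup_{[0,b]} u₀ + 1), M). -/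
open Set MeasureTheory Real

noncomputable section

/-- The space-time domain `Q_{s,T} = {(x,t) : 0 < x < s(t), 0 < t < T}`. -/
def stefanQ (T : ℝ) (s : ℝ → ℝ) : Set (ℝ × ℝ) :=
  {p : ℝ × ℝ | 0 < p.1 ∧ p.1 < s p.2 ∧ 0 < p.2 ∧ p.2 < T}

/-- A classical solution `(s, u)` of the one-phase Stefan problem with data `(b, u₀, h)`
on `[0,T]`. -/
structure IsStefanSolution (b T : ℝ) (u₀ h : ℝ → ℝ) (s : ℝ → ℝ) (u : ℝ → ℝ → ℝ) : Prop where
  s_pos : ∀ t ∈ Icc (0:ℝ) T, 0 < s t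
  s_init : s 0 = b
  s_lipschitz : ∃ L : NNReal, LipschitzOnWith L s (Icc 0 T)
  s_diff : ∀ t ∈ Ioc (0:ℝ) T, HasDerivAt s (deriv s t) t
  s_deriv_cont : ContinuousOn (deriv s) (Ioc 0 T)
  u_cont : ContinuousOn (fun p : ℝ × ℝ => u p.1 p.2) (closure (stefanQ T s))
  u_x : ∀ x t, (x, t) ∈ stefanQ T s →
    HasDerivAt (fun y => u y t) (deriv (fun y => u y t) x) x
  u_xx : ∀ x t, (x, t) ∈ stefanQ T s →
    HasDerivAt (fun y => deriv (fun z => u z t) y)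
      (deriv (fun y => deriv (fun z => u z t) y) x) x
  heat : ∀ x t, (x, t) ∈ stefanQ T s →
    HasDerivAt (fun τ => u x τ) (deriv (fun y => deriv (fun z => u z t) y) x) t
  flux : ∀ t ∈ Ioo (0:ℝ) T, deriv (fun y => u y t) 0 = -(h t)
  init : ∀ x ∈ Ioo (0:ℝ) b, u x 0 = u₀ x
  stefan_cond : ∀ t ∈ Ioo (0:ℝ) T, deriv (fun y => u y t) (s t) = -(deriv s t)
  front_zero : ∀ t ∈ Ioo (0:ℝ) T, u (s t) t = 0

/-- The `W^{1,∞}` norm of `s` on `[0,T]`: `max(sup |s|, ess sup |s'|)`. -/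
def W1inf (T : ℝ) (s : ℝ → ℝ) : ℝ :=
  max (sSup ((fun t => |s t|) '' Icc (0:ℝ) T))
    (essSup (fun t => |deriv s t|) (volume.restrict (Icc (0:ℝ) T)))

/-- The heat kernel `K(x,ξ;t,τ)`. -/
def Kker (x ξ t τ : ℝ) : ℝ :=
  (2 * Real.sqrt (π * (t - τ)))⁻¹ * Real.exp (-(x - ξ)^2 / (4 * (t - τ)))

/-- The Neumann function `N(x,ξ;t,τ) = K(x,ξ;t,τ) + K(-x,ξ;t,τ)`. -/
def Nker (x ξ t τ : ℝ) : ℝ := Kker x ξ t τ + Kker (-x) ξ t τ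

/-- The Abel operator `A₀ g (t) = (1/√π) ∫₀ᵗ g(τ)/√(t-τ) dτ`. -/
def abelOp (g : ℝ → ℝ) (t : ℝ) : ℝ :=
  (Real.sqrt π)⁻¹ * ∫ τ in (0:ℝ)..t, g τ / Real.sqrt (t - τ)

open Filter Topology

lemma HasDerivAt.nonneg_of_left_le {g : ℝ → ℝ} {d a x : ℝ} (hax : a < x) (hg : HasDerivAt g d x)
    (h : ∀ y ∈ Ioo a x, g y ≤ g x) : 0 ≤ d := by
  have h1 : Tendsto (slope g x) (𝓝[<] x) (𝓝 d) :=
    (hasDerivWithinAt_iff_tendsto_slope' (by simp)).1 (hg.hasDerivWithinAt (s := Iio x))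
  refine ge_of_tendsto h1 ?_
  filter_upwards [Ioo_mem_nhdsLT hax] with y hy
  rw [slope_def_field]
  exact div_nonneg_of_nonpos (by linarith [h y hy]) (by linarith [hy.2])

lemma HasDerivAt.nonpos_of_right_le {g : ℝ → ℝ} {d a x : ℝ} (hax : x < a) (hg : HasDerivAt g d x)
    (h : ∀ y ∈ Ioo x a, g y ≤ g x) : d ≤ 0 := by
  have h1 : Tendsto (slope g x) (𝓝[>] x) (𝓝 d) :=
    (hasDerivWithinAt_iff_tendsto_slope' (by simp)).1 (hg.hasDerivWithinAt (s := Ioi x))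
  refine le_of_tendsto h1 ?_
  filter_upwards [Ioo_mem_nhdsGT hax] with y hy
  rw [slope_def_field]
  exact div_nonpos_of_nonpos_of_nonneg (by linarith [h y hy]) (by linarith [hy.1])

lemma IsLocalMax.second_deriv_nonpos {f p : ℝ → ℝ} {q x : ℝ} (hf : IsLocalMax f x)
    (hp : ∀ᶠ y in 𝓝 x, HasDerivAt f (p y) y) (hq : HasDerivAt p q x) : q ≤ 0 := by
  by_contra! hq0
  have hd : deriv f =ᶠ[𝓝 x] p := hp.mono fun y hy => hy.deriv
  have hdd : deriv (deriv f) x = q := by rw [hd.deriv_eq, hq.deriv]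
  have hmin : IsLocalMin f x := isLocalMin_of_deriv_deriv_pos (by rw [hdd]; exact hq0)
    hf.deriv_eq_zero hp.self_of_nhds.continuousAt
  have hc : f =ᶠ[𝓝 x] fun _ => f x := by
    filter_upwards [hf, hmin] with y h1 h2 using le_antisymm h1 h2
  have := hc.deriv.deriv_eq
  rw [hdd] at this
  simp at this
  linarith

/-- `v` solves the heat equation pointwise on `(α, β) × (t₀, t₁]`, with `p = v_x` and
`q = v_xx = v_t`. -/
def HeatOn (v p q : ℝ → ℝ → ℝ) (α β t₀ t₁ : ℝ) : Prop :=
  ∀ x ∈ Ioo α β, ∀ t ∈ Ioc t₀ t₁, HasDerivAt (fun y => v y t) (p x t) x ∧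
    HasDerivAt (fun y => p y t) (q x t) x ∧ HasDerivAt (fun τ => v x τ) (q x t) t

lemma hasDerivAt_barrier_left (C K a k x₀ X y : ℝ) :
    HasDerivAt (fun y => C * (X - y) - K * (X - y) ^ 2 + a * ((X - x₀) ^ 2 + (y - x₀) ^ 2) + k)
      (-C + 2 * K * (X - y) + 2 * a * (y - x₀)) y := by
  have e1 : HasDerivAt (fun y : ℝ => X - y) (-1) y := (hasDerivAt_id y).const_sub X
  have e2 : HasDerivAt (fun y : ℝ => y - x₀) 1 y := (hasDerivAt_id y).sub_const x₀
  refine ((((e1.const_mul C).sub ((e1.pow 2).const_mul K)).add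
    (((e2.pow 2).const_add ((X - x₀) ^ 2)).const_mul a)).add_const k).congr_deriv ?_
  norm_num
  ring

lemma hasDerivAt_barrier_right (C K a k x₀ x Y : ℝ) :
    HasDerivAt (fun x => C * (x - Y) - K * (x - Y) ^ 2 + a * ((x - x₀) ^ 2 + (Y - x₀) ^ 2) + k)
      (C - 2 * K * (x - Y) + 2 * a * (x - x₀)) x := by
  have e1 : HasDerivAt (fun y : ℝ => y - Y) 1 x := (hasDerivAt_id x).sub_const Y
  have e2 : HasDerivAt (fun y : ℝ => y - x₀) 1 x := (hasDerivAt_id x).sub_const x₀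
  refine ((((e1.const_mul C).sub ((e1.pow 2).const_mul K)).add
    (((e2.pow 2).add_const ((Y - x₀) ^ 2)).const_mul a)).add_const k).congr_deriv ?_
  norm_num
  ring

set_option maxHeartbeats 1000000 in
/-- One-sided Lipschitz bound at `x₀`, by comparing `v y t - v x t` with a quadratic barrier.
The left end of the window is either at distance `r` or carries a Neumann condition at `x₀`. -/
lemma HeatOn.sub_le {v p q : ℝ → ℝ → ℝ} {α β t₀ t₁ x₀ r A C K : ℝ} (hr : 0 < r) (ht : t₀ < t₁)
    (hA : 0 < A) (hK : 2 * A / r ^ 2 + A / (t₁ - t₀) ≤ K) (hC : 4 * K * r ≤ C)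
    (hβ : β = x₀ + r)
    (hv : ContinuousOn (fun z : ℝ × ℝ => v z.1 z.2) (Icc α β ×ˢ Icc t₀ t₁))
    (hbd : ∀ x ∈ Icc α β, ∀ t ∈ Icc t₀ t₁, |v x t| ≤ A)
    (hheat : HeatOn v p q α β t₀ t₁)
    (hleft : α = x₀ - r ∨ (α = x₀ ∧ ∀ t ∈ Ioc t₀ t₁, ∃ d, HasDerivAt (fun y => v y t) d α ∧
      4 * K * r - C < d)) :
    ∀ x ∈ Icc x₀ β, v x₀ t₁ - v x t₁ ≤ (C + 2 * A / r) * (x - x₀) := by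
  obtain ⟨a, ha⟩ : ∃ a, a = 2 * A / r ^ 2 := ⟨_, rfl⟩
  obtain ⟨e, he⟩ : ∃ e, e = 2 * A / (t₁ - t₀) := ⟨_, rfl⟩
  have htt : 0 < t₁ - t₀ := by linarith
  have ha0 : 0 < a := by rw [ha]; positivity
  have he0 : 0 < e := by rw [he]; positivity
  have har : a * r ^ 2 = 2 * A := by rw [ha]; field_simp
  have het : e * (t₁ - t₀) = 2 * A := by rw [he]; field_simp
  have hK' : a + e / 2 ≤ K := by
    have : e / 2 = A / (t₁ - t₀) := by rw [he]; ring
    rw [ha, this]; exact hK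
  have hK0 : 0 < K := by linarith
  have hαx : α ≤ x₀ ∧ x₀ - r ≤ α := by
    rcases hleft with h | ⟨h, -⟩ <;> constructor <;> linarith
  let φ : ℝ → ℝ → ℝ → ℝ := fun x y t =>
    C * (x - y) - K * (x - y) ^ 2 + a * ((x - x₀) ^ 2 + (y - x₀) ^ 2) + e * (t₁ - t)
  let f : ℝ × ℝ × ℝ → ℝ := fun z => v z.2.1 z.2.2 - v z.1 z.2.2 - φ z.1 z.2.1 z.2.2
  let S : Set (ℝ × ℝ × ℝ) := (Icc α β ×ˢ Icc α β ×ˢ Icc t₀ t₁) ∩ {z | z.2.1 ≤ z.1}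
  have hS : IsCompact S := by
    refine (isCompact_Icc.prod (isCompact_Icc.prod isCompact_Icc)).inter_right ?_
    exact isClosed_le (by fun_prop) (by fun_prop)
  have hfS : ContinuousOn f S := by
    refine ContinuousOn.sub (ContinuousOn.sub ?_ ?_) ?_
    · exact hv.comp (f := fun z : ℝ × ℝ × ℝ => (z.2.1, z.2.2)) (by fun_prop)
        fun z hz => ⟨hz.1.2.1, hz.1.2.2⟩
    · exact hv.comp (f := fun z : ℝ × ℝ × ℝ => (z.1, z.2.2)) (by fun_prop)
        fun z hz => ⟨hz.1.1, hz.1.2.2⟩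
    · simp only [φ]; fun_prop
  have hx₀ : x₀ ∈ Icc α β := ⟨hαx.1, by linarith⟩
  have hSne : S.Nonempty := ⟨(x₀, x₀, t₁), ⟨hx₀, hx₀, ht.le, le_rfl⟩, le_refl x₀⟩
  obtain ⟨⟨X, Y, τ⟩, ⟨⟨hX, hY, hτ⟩, hYX⟩, hmax⟩ := hS.exists_isMaxOn hSne hfS
  simp only [mem_ofPred_eq] at hYX hX hY hτ
  have hmax' : ∀ x ∈ Icc α β, ∀ y ∈ Icc α β, ∀ t ∈ Icc t₀ t₁, y ≤ x →
      v y t - v x t - φ x y t ≤ v Y τ - v X τ - φ X Y τ := fun x hx y hy t ht' hyx =>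
    hmax (a := (x, y, t)) ⟨⟨hx, hy, ht'⟩, hyx⟩
  have key : v Y τ - v X τ - φ X Y τ ≤ 0 := by
    by_contra! hpos
    have hd2 : X - Y ≤ 2 * r := by linarith [hX.2, hY.1]
    have hd0 : 0 ≤ X - Y := by linarith
    have h1 : 0 ≤ C * (X - Y) - K * (X - Y) ^ 2 := by
      have : 0 ≤ C - K * (X - Y) := by nlinarith
      nlinarith
    have h2 : 0 ≤ a * (X - x₀) ^ 2 := by positivity
    have h3 : 0 ≤ a * (Y - x₀) ^ 2 := by positivity
    have h4 : 0 ≤ e * (t₁ - τ) := mul_nonneg he0.le (by linarith [hτ.2])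
    have hz : v Y τ - v X τ ≤ 2 * A := by
      linarith [(abs_le.1 (hbd Y hY τ hτ)).2, (abs_le.1 (hbd X hX τ hτ)).1]
    have hφ : φ X Y τ < v Y τ - v X τ := by linarith
    simp only [φ, mul_add] at hφ
    have hτ0 : t₀ < τ := by
      refine lt_of_le_of_ne hτ.1 fun h => ?_
      rw [← h] at hφ h4
      rw [← h] at hz
      linarith
    have hXβ : X < β := by
      refine lt_of_le_of_ne hX.2 fun h => ?_
      have : X - x₀ = r := by linarith
      rw [this, har] at hφ
      linarith
    have hYX' : Y < X := by
      refine lt_of_le_of_ne hYX fun h => ?_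
      subst h
      simp at hφ
      linarith
    have hYα : α < Y := by
      refine lt_of_le_of_ne hY.1 fun h => ?_
      rcases hleft with h' | ⟨h', hN⟩
      · have : Y - x₀ = -r := by linarith
        rw [this] at hφ
        nlinarith
      · obtain ⟨d, hd, hdC⟩ := hN τ ⟨hτ0, hτ.2⟩
        rw [h] at hd
        have hD : HasDerivAt (fun y => v y τ - v X τ - φ X y τ)
            (d - (-C + 2 * K * (X - Y) + 2 * a * (Y - x₀))) Y := by
          exact (hd.sub_const _).sub (hasDerivAt_barrier_left C K a _ x₀ X Y)
        have := hD.nonpos_of_right_le hYX' fun y hy =>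
          hmax' X hX y ⟨by linarith [hy.1], by linarith [hy.2]⟩ τ hτ hy.2.le
        have hYx : Y - x₀ = 0 := by linarith
        rw [hYx] at this
        nlinarith
    have hXI : X ∈ Ioo α β := ⟨by linarith, hXβ⟩
    have hYI : Y ∈ Ioo α β := ⟨hYα, by linarith⟩
    have hτI : τ ∈ Ioc t₀ t₁ := ⟨hτ0, hτ.2⟩
    have hqX : - q X τ + 2 * K - 2 * a ≤ 0 := by
      refine IsLocalMax.second_deriv_nonpos (f := fun x => v Y τ - v x τ - φ x Y τ)
        (p := fun x => - p x τ - (C - 2 * K * (x - Y) + 2 * a * (x - x₀))) (x := X) ?_ ?_ ?_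
      · filter_upwards [Ioo_mem_nhds hYX' hXβ] with x hx
        exact hmax' x ⟨by linarith [hx.1], hx.2.le⟩ Y hY τ hτ hx.1.le
      · filter_upwards [Ioo_mem_nhds hYX' hXβ] with x hx
        exact ((hheat x ⟨by linarith [hx.1], hx.2⟩ τ hτI).1.const_sub _).sub
          (hasDerivAt_barrier_right C K a _ x₀ x Y)
      · have e1 : HasDerivAt (fun y : ℝ => y - Y) 1 X := (hasDerivAt_id X).sub_const Y
        have e2 : HasDerivAt (fun y : ℝ => y - x₀) 1 X := (hasDerivAt_id X).sub_const x₀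
        exact ((hheat X hXI τ hτI).2.1.neg.sub
          (((e1.const_mul (2 * K)).const_sub C).add (e2.const_mul (2 * a)))).congr_deriv (by ring)
    have hqY : q Y τ + 2 * K - 2 * a ≤ 0 := by
      refine IsLocalMax.second_deriv_nonpos (f := fun y => v y τ - v X τ - φ X y τ)
        (p := fun y => p y τ - (-C + 2 * K * (X - y) + 2 * a * (y - x₀))) (x := Y) ?_ ?_ ?_
      · filter_upwards [Ioo_mem_nhds hYα hYX'] with y hy
        exact hmax' X hX y ⟨hy.1.le, by linarith [hy.2]⟩ τ hτ hy.2.le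
      · filter_upwards [Ioo_mem_nhds hYα hYX'] with y hy
        exact ((hheat y ⟨hy.1, by linarith [hy.2]⟩ τ hτI).1.sub_const _).sub
          (hasDerivAt_barrier_left C K a _ x₀ X y)
      · have e1 : HasDerivAt (fun y : ℝ => X - y) (-1) Y := (hasDerivAt_id Y).const_sub X
        have e2 : HasDerivAt (fun y : ℝ => y - x₀) 1 Y := (hasDerivAt_id Y).sub_const x₀
        exact ((hheat Y hYI τ hτI).2.1.sub
          (((e1.const_mul (2 * K)).const_add (-C)).add (e2.const_mul (2 * a)))).congr_deriv
          (by ring)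
    have hqt : 0 ≤ q Y τ - q X τ + e := by
      refine HasDerivAt.nonneg_of_left_le (g := fun t => v Y t - v X t - φ X Y t) hτ0 ?_
        fun t ht' => hmax' X hX Y hY t ⟨ht'.1.le, by linarith [ht'.2, hτ.2]⟩ hYX
      have hφd : HasDerivAt (fun t => φ X Y t) (-e) τ := by
        have e1 : HasDerivAt (fun t : ℝ => t₁ - t) (-1) τ := (hasDerivAt_id τ).const_sub t₁
        exact ((e1.const_mul e).const_add
          (C * (X - Y) - K * (X - Y) ^ 2 + a * ((X - x₀) ^ 2 + (Y - x₀) ^ 2))).congr_deriv (by ring)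
      exact (((hheat Y hYI τ hτI).2.2.sub (hheat X hXI τ hτI).2.2).sub hφd).congr_deriv (by ring)
    linarith
  intro x hx
  have h1 := (hmax' x ⟨by linarith [hx.1], hx.2⟩ x₀ hx₀ t₁ ⟨ht.le, le_rfl⟩ hx.1).trans key
  simp only [φ] at h1
  have h2 : a * (x - x₀) ^ 2 ≤ 2 * A / r * (x - x₀) := by
    have h3 : a * r = 2 * A / r := by rw [ha]; field_simp
    rw [← h3]
    have : 0 ≤ a * (x - x₀) := mul_nonneg ha0.le (by linarith [hx.1])
    nlinarith [hx.2]
  have h4 : 0 ≤ K * (x - x₀) ^ 2 := by positivity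
  nlinarith

lemma HeatOn.mono {v p q : ℝ → ℝ → ℝ} {α β t₀ t₁ α' β' t₀' t₁' : ℝ} (h : HeatOn v p q α β t₀ t₁)
    (hα : α ≤ α') (hβ : β' ≤ β) (h₀ : t₀ ≤ t₀') (h₁ : t₁' ≤ t₁) :
    HeatOn v p q α' β' t₀' t₁' := fun x hx t ht =>
  h x ⟨by linarith [hx.1], by linarith [hx.2]⟩ t ⟨by linarith [ht.1], by linarith [ht.2]⟩

lemma HeatOn.neg {v p q : ℝ → ℝ → ℝ} {α β t₀ t₁ : ℝ} (h : HeatOn v p q α β t₀ t₁) :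
    HeatOn (fun x t => -v x t) (fun x t => -p x t) (fun x t => -q x t) α β t₀ t₁ :=
  fun x hx t ht => ⟨(h x hx t ht).1.neg, (h x hx t ht).2.1.neg, (h x hx t ht).2.2.neg⟩

/-- The constant in the interior Lipschitz estimate on a window of half-width `r` and length `ρ`. -/
def heatLip (r ρ : ℝ) : ℝ := 4 * (2 / r ^ 2 + 1 / ρ) * r + 2 / r

lemma heatLip_pos {r ρ : ℝ} (hr : 0 < r) (hρ : 0 < ρ) : 0 < heatLip r ρ := by
  unfold heatLip; positivity

lemma HeatOn.abs_sub_le {v p q : ℝ → ℝ → ℝ} {x₀ t₁ r ρ A : ℝ} (hr : 0 < r) (hρ : 0 < ρ)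
    (hA : 0 < A)
    (hv : ContinuousOn (fun z : ℝ × ℝ => v z.1 z.2) (Icc (x₀ - r) (x₀ + r) ×ˢ Icc (t₁ - ρ) t₁))
    (hbd : ∀ x ∈ Icc (x₀ - r) (x₀ + r), ∀ t ∈ Icc (t₁ - ρ) t₁, |v x t| ≤ A)
    (h : HeatOn v p q (x₀ - r) (x₀ + r) (t₁ - ρ) t₁) :
    ∀ x ∈ Icc x₀ (x₀ + r), |v x t₁ - v x₀ t₁| ≤ heatLip r ρ * A * (x - x₀) := by
  intro x hx
  have hc : 4 * ((2 / r ^ 2 + 1 / ρ) * A) * r + 2 * A / r = heatLip r ρ * A := by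
    unfold heatLip; ring
  have hK : 2 * A / r ^ 2 + A / (t₁ - (t₁ - ρ)) ≤ (2 / r ^ 2 + 1 / ρ) * A := by
    rw [sub_sub_cancel]; apply le_of_eq; ring
  have h1 := h.sub_le hr (by linarith) hA hK le_rfl rfl hv hbd (Or.inl rfl) x hx
  have h2 := h.neg.sub_le hr (by linarith) hA hK le_rfl rfl hv.neg
    (by simpa only [abs_neg] using hbd) (Or.inl rfl) x hx
  rw [hc] at h1 h2
  rw [abs_le]
  constructor <;> linarith

/-- Interior bound for the second space derivative. -/
lemma HeatOn.abs_second_le {v p q : ℝ → ℝ → ℝ} {a c t₀ t₁ r ρ A : ℝ} (hr : 0 < r) (hρ : 0 < ρ)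
    (hA : 0 < A)
    (hv : ContinuousOn (fun z : ℝ × ℝ => v z.1 z.2)
      (Icc (a - 3 * r) (c + 3 * r) ×ˢ Icc (t₀ - 2 * ρ) t₁))
    (hbd : ∀ x ∈ Icc (a - 3 * r) (c + 3 * r), ∀ t ∈ Icc (t₀ - 2 * ρ) t₁, |v x t| ≤ A)
    (h : HeatOn v p q (a - 3 * r) (c + 3 * r) (t₀ - 2 * ρ) t₁) :
    ∀ x ∈ Icc a c, ∀ t ∈ Icc t₀ t₁, |q x t| ≤ heatLip r ρ * (heatLip r ρ * A) := by
  have hL := heatLip_pos hr hρ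
  have hlip : ∀ x₀ ∈ Icc (a - 2 * r) (c + 2 * r), ∀ t ∈ Icc (t₀ - ρ) t₁,
      ∀ x ∈ Icc x₀ (x₀ + r), |v x t - v x₀ t| ≤ heatLip r ρ * A * (x - x₀) := by
    intro x₀ hx₀ t ht
    refine HeatOn.abs_sub_le hr hρ hA (hv.mono ?_) ?_ (h.mono ?_ ?_ ?_ ?_)
    · refine prod_mono (Icc_subset_Icc ?_ ?_) (Icc_subset_Icc ?_ ?_) <;>
        linarith [hx₀.1, hx₀.2, ht.1, ht.2]
    · intro x hx s hs
      exact hbd x ⟨by linarith [hx₀.1, hx.1], by linarith [hx₀.2, hx.2]⟩ s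
        ⟨by linarith [ht.1, hs.1], by linarith [ht.2, hs.2]⟩
    all_goals linarith [hx₀.1, hx₀.2, ht.1, ht.2]
  have hdq : ∀ x₀ ∈ Icc a c, ∀ t ∈ Icc t₀ t₁, ∀ x ∈ Icc x₀ (x₀ + r), ∀ k ∈ Ioo 0 r,
      |(v (x + k) t - v x t) / k - (v (x₀ + k) t - v x₀ t) / k| ≤
        heatLip r ρ * (heatLip r ρ * A) * (x - x₀) := by
    intro x₀ hx₀ t ht x hx k hk
    refine HeatOn.abs_sub_le (v := fun x t => (v (x + k) t - v x t) / k)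
      (p := fun x t => (p (x + k) t - p x t) / k) (q := fun x t => (q (x + k) t - q x t) / k)
      hr hρ (mul_pos hL hA) ?_ ?_ ?_ x hx
    · refine ContinuousOn.div_const (ContinuousOn.sub ?_ ?_) _
      · refine hv.comp (f := fun z : ℝ × ℝ => (z.1 + k, z.2)) (by fun_prop) fun z hz => ?_
        have h1 := hz.1; have h2 := hz.2
        exact ⟨⟨by linarith [hx₀.1, h1.1, hk.1], by linarith [hx₀.2, h1.2, hk.2]⟩,
          ⟨by linarith [ht.1, h2.1], by linarith [ht.2, h2.2]⟩⟩
      · refine hv.mono (prod_mono (Icc_subset_Icc ?_ ?_) (Icc_subset_Icc ?_ ?_)) <;>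
          linarith [hx₀.1, hx₀.2, ht.1, ht.2]
    · intro y hy s hs
      rw [abs_div, abs_of_pos hk.1, div_le_iff₀ hk.1]
      have := hlip y ⟨by linarith [hx₀.1, hy.1], by linarith [hx₀.2, hy.2]⟩ s
        ⟨by linarith [ht.1, hs.1], by linarith [ht.2, hs.2]⟩ (y + k)
        ⟨by linarith [hk.1], by linarith [hk.2]⟩
      simpa using this
    · intro y hy s hs
      have hs' : s ∈ Ioc (t₀ - 2 * ρ) t₁ := ⟨by linarith [ht.1, hs.1], by linarith [ht.2, hs.2]⟩
      have h1 := h y ⟨by linarith [hx₀.1, hy.1], by linarith [hx₀.2, hy.2]⟩ s hs'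
      have h2 := h (y + k) ⟨by linarith [hx₀.1, hy.1, hk.1], by linarith [hx₀.2, hy.2, hk.2]⟩ s hs'
      exact ⟨((h2.1.comp_add_const y k).sub h1.1).div_const k,
        ((h2.2.1.comp_add_const y k).sub h1.2.1).div_const k, (h2.2.2.sub h1.2.2).div_const k⟩
  have quot : ∀ x ∈ Icc a (c + r), ∀ t ∈ Icc t₀ t₁,
      Tendsto (fun k => (v (x + k) t - v x t) / k) (𝓝[>] 0) (𝓝 (p x t)) := by
    intro x hx t ht
    have h1 := (h x ⟨by linarith [hx.1], by linarith [hx.2]⟩ t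
      ⟨by linarith [ht.1], ht.2⟩).1.tendsto_slope_zero_right
    refine h1.congr fun k => ?_
    rw [smul_eq_mul]; ring
  intro x₀ hx₀ t ht
  have hx₀c : x₀ ∈ Icc a (c + r) := ⟨hx₀.1, by linarith [hx₀.2]⟩
  have hp_lip : ∀ x ∈ Icc x₀ (x₀ + r), |p x t - p x₀ t| ≤
      heatLip r ρ * (heatLip r ρ * A) * (x - x₀) := by
    intro x hx
    refine le_of_tendsto ((quot x ⟨by linarith [hx.1, hx₀.1], by linarith [hx.2, hx₀.2]⟩ t ht).sub
      (quot x₀ hx₀c t ht)).abs ?_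
    filter_upwards [Ioo_mem_nhdsGT hr] with k hk using hdq x₀ hx₀ t ht x hx k hk
  have h1 := (h x₀ ⟨by linarith [hx₀.1], by linarith [hx₀.2]⟩ t
      ⟨by linarith [ht.1], ht.2⟩).2.1.tendsto_slope_zero_right
  refine le_of_tendsto h1.abs ?_
  filter_upwards [Ioo_mem_nhdsGT hr] with k hk
  rw [smul_eq_mul, abs_mul, abs_inv, abs_of_pos hk.1, inv_mul_le_iff₀ hk.1]
  have := hp_lip (x₀ + k) ⟨by linarith [hk.1], by linarith [hk.2]⟩
  rw [add_sub_cancel_left] at this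
  linarith

/-- Differentiation under the integral sign for solutions of the heat equation. -/
lemma HeatOn.hasDerivAt_integral {v p q : ℝ → ℝ → ℝ} {α β τ₀ τ₁ a c t : ℝ}
    (h : HeatOn v p q α β τ₀ τ₁)
    (hv : ContinuousOn (fun z : ℝ × ℝ => v z.1 z.2) (Icc α β ×ˢ Icc τ₀ τ₁))
    (ha : α < a) (hac : a ≤ c) (hc : c < β) (ht : t ∈ Ioo τ₀ τ₁) {w : ℝ → ℝ} (hw : Continuous w) :
    IntervalIntegrable (fun z => w z * q z t) volume a c ∧
    HasDerivAt (fun τ => ∫ z in a..c, w z * v z τ) (∫ z in a..c, w z * q z t) t := by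
  obtain ⟨r, hr, hra, hrc⟩ : ∃ r > 0, α ≤ a - 3 * r ∧ c + 3 * r ≤ β := by
    refine ⟨min (a - α) (β - c) / 3, by have := lt_min (sub_pos.2 ha) (sub_pos.2 hc); positivity,
      ?_, ?_⟩
    · linarith [min_le_left (a - α) (β - c)]
    · linarith [min_le_right (a - α) (β - c)]
  obtain ⟨ρ, hρ, hρt⟩ : ∃ ρ > 0, τ₀ ≤ t - ρ - 2 * ρ := ⟨(t - τ₀) / 3, by linarith [ht.1], by linarith⟩
  obtain ⟨A, hA⟩ := (isCompact_Icc.prod isCompact_Icc).exists_bound_of_continuousOn hv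
  have hA' : ∀ x ∈ Icc α β, ∀ s ∈ Icc τ₀ τ₁, |v x s| ≤ |A| + 1 := fun x hx s hs => by
    have := hA (x, s) ⟨hx, hs⟩
    rw [Real.norm_eq_abs] at this
    linarith [le_abs_self A]
  have hq := HeatOn.abs_second_le (a := a) (c := c) (t₀ := t - ρ) (t₁ := τ₁) hr hρ
    (A := |A| + 1) (by positivity)
    (hv.mono (prod_mono (Icc_subset_Icc hra hrc) (Icc_subset_Icc hρt le_rfl)))
    (fun x hx s hs => hA' x ⟨hra.trans hx.1, hx.2.trans hrc⟩ s ⟨hρt.trans hs.1, hs.2⟩)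
    (h.mono hra hrc hρt le_rfl)
  set B := heatLip r ρ * (heatLip r ρ * (|A| + 1)) with hB
  have hmv : ∀ s ∈ Ioo τ₀ τ₁, ContinuousOn (fun z => v z s) (uIcc a c) := by
    intro s hs
    refine hv.comp (f := fun z : ℝ => (z, s)) (by fun_prop) fun z hz => ?_
    rw [uIcc_of_le hac] at hz
    exact ⟨⟨by linarith [hz.1], by linarith [hz.2]⟩, hs.1.le, hs.2.le⟩
  refine intervalIntegral.hasDerivAt_integral_of_dominated_loc_of_deriv_le
    (F := fun τ z => w z * v z τ) (F' := fun τ z => w z * q z τ) (bound := fun z => |w z| * B)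
    (Ioo_mem_nhds (show t - ρ < t by linarith) ht.2) ?_ ?_ ?_ ?_ ?_ ?_
  · filter_upwards [Ioo_mem_nhds ht.1 ht.2] with s hs
    exact ((hw.continuousOn.mul (hmv s hs)).mono uIoc_subset_uIcc).aestronglyMeasurable
      measurableSet_uIoc
  · exact (hw.continuousOn.mul (hmv t ht)).intervalIntegrable
  · refine hw.aestronglyMeasurable.mul ?_
    refine (measurable_deriv (fun y => p y t)).aestronglyMeasurable.congr ?_
    refine (ae_restrict_iff' measurableSet_uIoc).2 (Eventually.of_forall fun z hz => ?_)
    rw [uIoc_of_le hac] at hz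
    exact (h z ⟨by linarith [hz.1], by linarith [hz.2]⟩ t ⟨ht.1, ht.2.le⟩).2.1.deriv
  · refine Eventually.of_forall fun z hz s hs => ?_
    rw [uIoc_of_le hac] at hz
    rw [norm_mul, Real.norm_eq_abs, Real.norm_eq_abs]
    exact mul_le_mul_of_nonneg_left (hq z ⟨hz.1.le, hz.2⟩ s ⟨hs.1.le, hs.2.le⟩) (abs_nonneg _)
  · exact (hw.abs.mul continuous_const).intervalIntegrable _ _
  · refine Eventually.of_forall fun z hz s hs => ?_
    rw [uIoc_of_le hac] at hz
    exact (h z ⟨by linarith [hz.1], by linarith [hz.2]⟩ s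
      ⟨by linarith [hs.1], hs.2.le⟩).2.2.const_mul (w z)

/-- Time derivative of `∫ z in a..c t, (c t - z) * v z t` along a differentiable curve `c`. -/
lemma HeatOn.hasDerivAt_double_integral {v p q : ℝ → ℝ → ℝ} {α β τ₀ τ₁ a t c' : ℝ} {c : ℝ → ℝ}
    (h : HeatOn v p q α β τ₀ τ₁)
    (hv : ContinuousOn (fun z : ℝ × ℝ => v z.1 z.2) (Icc α β ×ˢ Icc τ₀ τ₁))
    (ha : α < a) (hac : a ≤ c t) (hc : c t < β) (ht : t ∈ Ioo τ₀ τ₁) (hcd : HasDerivAt c c' t) :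
    HasDerivAt (fun τ => ∫ z in a..c τ, (c τ - z) * v z τ)
      (v (c t) t - v a t - (c t - a) * p a t + c' * ∫ z in a..c t, v z t) t := by
  obtain ⟨A, hA⟩ := (isCompact_Icc.prod isCompact_Icc).exists_bound_of_continuousOn hv
  have hI : ∀ s ∈ Ioo τ₀ τ₁, ∀ x ∈ Icc α β, ∀ y ∈ Icc α β, ∀ w : ℝ → ℝ, Continuous w →
      IntervalIntegrable (fun z => w z * v z s) volume x y := by
    intro s hs x hx y hy w hw
    refine (hw.continuousOn.mul (hv.comp (f := fun z : ℝ => (z, s)) (by fun_prop)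
      fun z hz => ?_)).intervalIntegrable
    exact ⟨uIcc_subset_Icc hx hy hz, hs.1.le, hs.2.le⟩
  have hct : c t ∈ Icc α β := ⟨by linarith, hc.le⟩
  have haI : a ∈ Icc α β := ⟨ha.le, by linarith⟩
  have hev : ∀ᶠ s in 𝓝 t, c s ∈ Icc α β :=
    hcd.continuousAt.eventually_mem (Icc_mem_nhds (by linarith) hc)
  have d1 := (h.hasDerivAt_integral hv ha hac hc ht (w := fun z => c t - z) (by fun_prop))
  have d2 := (h.hasDerivAt_integral hv ha hac hc ht (w := fun _ => 1) (by fun_prop)).2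
  simp only [one_mul] at d2
  have e1 : ∫ z in a..c t, (c t - z) * q z t = v (c t) t - v a t - (c t - a) * p a t := by
    have := intervalIntegral.integral_eq_sub_of_hasDerivAt (a := a) (b := c t)
      (f := fun z => (c t - z) * p z t + v z t) (f' := fun z => (c t - z) * q z t) ?_ d1.1
    · rw [this]; ring
    · intro z hz
      rw [uIcc_of_le hac] at hz
      have hh := h z ⟨by linarith [hz.1], by linarith [hz.2]⟩ t ⟨ht.1, ht.2.le⟩
      exact ((((hasDerivAt_id z).const_sub (c t)).mul hh.2.1).add hh.1).congr_deriv
        (by simp)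
  have d1' := d1.2
  rw [e1] at d1'
  have d3 : HasDerivAt (fun s => ∫ z in c t..c s, (c s - z) * v z s) 0 t := by
    have hO : (fun s => c s - c t) =O[𝓝 t] fun s => s - t := hcd.isBigO_sub
    have hsq : (fun s => (c s - c t) ^ 2) =o[𝓝 t] fun s => s - t := by
      have h1 : (fun s => (c s - c t) * (c s - c t)) =o[𝓝 t] fun s => (s - t) * 1 := by
        refine hO.mul_isLittleO ?_
        rw [Asymptotics.isLittleO_one_iff]
        simpa using (hcd.continuousAt.tendsto.sub_const (c t))
      simpa [sq] using h1
    rw [hasDerivAt_iff_isLittleO]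
    simp only [intervalIntegral.integral_same, sub_zero, smul_zero]
    refine Asymptotics.IsBigO.trans_isLittleO ?_ hsq
    refine Asymptotics.IsBigO.of_bound A ?_
    filter_upwards [hev, Ioo_mem_nhds ht.1 ht.2] with s hs hs'
    have : ‖∫ z in c t..c s, (c s - z) * v z s‖ ≤ |c s - c t| * A * |c s - c t| := by
      refine intervalIntegral.norm_integral_le_of_norm_le_const fun z hz => ?_
      rw [norm_mul]
      have hz' := uIoc_subset_uIcc hz
      refine mul_le_mul ?_ (hA (z, s) ⟨uIcc_subset_Icc hct hs hz', hs'.1.le, hs'.2.le⟩)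
        (norm_nonneg _) (abs_nonneg _)
      rw [Real.norm_eq_abs]
      exact abs_sub_right_of_mem_uIcc hz'
    rw [Real.norm_eq_abs (_ ^ 2), abs_pow]
    linarith
  have d4 := (d1'.add ((hcd.sub_const (c t)).mul d2)).add d3
  refine (d4.congr_of_eventuallyEq ?_).congr_deriv (by simp)
  filter_upwards [hev, Ioo_mem_nhds ht.1 ht.2] with s hs hs'
  have i1 := hI s hs' a haI (c t) hct (fun z => c t - z) (by fun_prop)
  have i2 := hI s hs' a haI (c t) hct (fun z => c s - c t) (by fun_prop)
  have i3 := hI s hs' a haI (c t) hct (fun z => c s - z) (by fun_prop)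
  have i4 := hI s hs' (c t) hct (c s) hs (fun z => c s - z) (by fun_prop)
  rw [← intervalIntegral.integral_add_adjacent_intervals i3 i4]
  simp only [Pi.add_apply, Pi.mul_apply]
  congr 1
  rw [← intervalIntegral.integral_const_mul, ← intervalIntegral.integral_add i1 i2]
  congr 1
  ext z
  ring

/-- The closed region under the front up to time `t₁`. -/
def stefanD (t₁ : ℝ) (s : ℝ → ℝ) : Set (ℝ × ℝ) :=
  {z | z.2 ∈ Icc 0 t₁ ∧ z.1 ∈ Icc 0 (s z.2)}

lemma isCompact_stefanD {t₁ : ℝ} {s : ℝ → ℝ} (hs : ContinuousOn s (Icc 0 t₁))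
    (hpos : ∀ t ∈ Icc 0 t₁, 0 < s t) : IsCompact (stefanD t₁ s) := by
  have himg : stefanD t₁ s = (fun z : ℝ × ℝ => (z.1 * s z.2, z.2)) '' (Icc 0 1 ×ˢ Icc 0 t₁) := by
    ext ⟨x, t⟩
    constructor
    · rintro ⟨ht, hx⟩
      have h := hpos t ht
      refine ⟨(x / s t, t), ⟨⟨div_nonneg hx.1 h.le, (div_le_one h).2 hx.2⟩, ht⟩, ?_⟩
      simp [div_mul_cancel₀ x h.ne']
    · rintro ⟨⟨ξ, τ⟩, ⟨hξ, hτ⟩, heq⟩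
      simp only [Prod.mk.injEq] at heq hξ hτ
      obtain ⟨rfl, rfl⟩ := heq
      have h := hpos _ hτ
      exact ⟨hτ, mul_nonneg hξ.1 h.le, mul_le_of_le_one_left h.le hξ.2⟩
  rw [himg]
  refine (isCompact_Icc.prod isCompact_Icc).image_of_continuousOn ?_
  refine ContinuousOn.prodMk (continuousOn_fst.mul ?_) continuousOn_snd
  exact hs.comp continuousOn_snd fun z hz => hz.2

lemma nonpos_of_no_pos_max {D : Set (ℝ × ℝ)} (hD : IsCompact D) {w : ℝ × ℝ → ℝ}
    (hw : ContinuousOn w D) (h : ∀ z ∈ D, 0 < w z → ¬ IsMaxOn w D z) : ∀ z ∈ D, w z ≤ 0 := by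
  intro z hz
  obtain ⟨z₀, hz₀, hmax⟩ := hD.exists_isMaxOn ⟨z, hz⟩ hw
  by_contra! hpos
  exact h z₀ hz₀ (hpos.trans_le (hmax hz)) hmax

namespace IsStefanSolution

variable {b T : ℝ} {u₀ h s : ℝ → ℝ} {u : ℝ → ℝ → ℝ}

lemma continuousOn_s (hsol : IsStefanSolution b T u₀ h s u) : ContinuousOn s (Icc 0 T) :=
  hsol.s_lipschitz.choose_spec.continuousOn

lemma continuousAt_s (hsol : IsStefanSolution b T u₀ h s u) {t : ℝ} (ht : t ∈ Ioo 0 T) :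
    ContinuousAt s t := (hsol.s_diff t ⟨ht.1, ht.2.le⟩).continuousAt

lemma stefanD_subset (hsol : IsStefanSolution b T u₀ h s u) (hT : 0 < T) :
    stefanD T s ⊆ closure (stefanQ T s) := by
  have hmaps : MapsTo (fun z : ℝ × ℝ => (z.1 * s z.2, z.2)) (Ioo 0 1 ×ˢ Ioo 0 T)
      (stefanQ T s) := by
    rintro ⟨ξ, t⟩ ⟨hξ, ht⟩
    have h := hsol.s_pos t ⟨ht.1.le, ht.2.le⟩
    exact ⟨mul_pos hξ.1 h, mul_lt_of_lt_one_left h hξ.2, ht.1, ht.2⟩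
  have hcl : closure (Ioo (0:ℝ) 1 ×ˢ Ioo 0 T) = Icc 0 1 ×ˢ Icc 0 T := by
    rw [closure_prod_eq, closure_Ioo (by norm_num), closure_Ioo hT.ne]
  have := hmaps.closure_of_continuousOn (by
    rw [hcl]
    exact ContinuousOn.prodMk (continuousOn_fst.mul
      (hsol.continuousOn_s.comp continuousOn_snd fun z hz => hz.2)) continuousOn_snd)
  rw [hcl] at this
  rintro ⟨x, t⟩ ⟨ht, hx⟩
  have h := hsol.s_pos t ht
  have h2 := this (x := (x / s t, t)) ⟨⟨div_nonneg hx.1 h.le, (div_le_one h).2 hx.2⟩, ht⟩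
  simpa [div_mul_cancel₀ x h.ne'] using h2

lemma continuousOn_u (hsol : IsStefanSolution b T u₀ h s u) (hT : 0 < T) :
    ContinuousOn (fun p : ℝ × ℝ => u p.1 p.2) (stefanD T s) :=
  hsol.u_cont.mono (hsol.stefanD_subset hT)

lemma u_initial (hsol : IsStefanSolution b T u₀ h s u) (hT : 0 < T) (hb : 0 < b)
    (hu₀c : ContinuousOn u₀ (Icc 0 b)) : ∀ x ∈ Icc 0 b, u x 0 = u₀ x := by
  have hc : ContinuousOn (fun x => u x 0) (Icc 0 b) := by
    refine (hsol.continuousOn_u hT).comp (f := fun x : ℝ => (x, (0:ℝ))) (by fun_prop)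
      fun x hx => ⟨⟨le_rfl, hT.le⟩, ?_⟩
    simpa only [hsol.s_init] using hx
  have : EqOn (fun x => u x 0) u₀ (Icc 0 b) :=
    EqOn.of_subset_closure (s := Ioo 0 b) (fun x hx => hsol.init x hx) hc hu₀c Ioo_subset_Icc_self
      (by rw [closure_Ioo hb.ne])
  exact this

lemma heatOn (hsol : IsStefanSolution b T u₀ h s u) {α β t₀ t₁ : ℝ} (hα : 0 ≤ α) (ht₀ : 0 ≤ t₀)
    (ht₁ : t₁ < T) (hβ : ∀ t ∈ Ioc t₀ t₁, β ≤ s t) :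
    HeatOn u (fun x t => deriv (fun y => u y t) x)
      (fun x t => deriv (fun y => deriv (fun z => u z t) y) x) α β t₀ t₁ := by
  intro x hx t ht
  have hQ : (x, t) ∈ stefanQ T s := ⟨by linarith [hx.1], hx.2.trans_le (hβ t ht),
    by linarith [ht.1], by linarith [ht.2]⟩
  exact ⟨hsol.u_x x t hQ, hsol.u_xx x t hQ, hsol.heat x t hQ⟩

lemma hasDerivAt_left (hsol : IsStefanSolution b T u₀ h s u)
    (hhpos : ∀ t ∈ Icc (0:ℝ) T, 0 < h t) {t : ℝ} (ht : t ∈ Ioo 0 T) :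
    HasDerivAt (fun y => u y t) (-h t) 0 := by
  have h1 := hsol.flux t ht
  have h2 := hhpos t ⟨ht.1.le, ht.2.le⟩
  rw [← h1]
  exact (differentiableAt_of_deriv_ne_zero (by rw [h1]; linarith)).hasDerivAt

lemma hasDerivAt_front (hsol : IsStefanSolution b T u₀ h s u) {t : ℝ} (ht : t ∈ Ioo 0 T)
    (hne : deriv s t ≠ 0) : HasDerivAt (fun y => u y t) (-deriv s t) (s t) := by
  have h1 := hsol.stefan_cond t ht
  rw [← h1]
  exact (differentiableAt_of_deriv_ne_zero (by rw [h1]; exact neg_ne_zero.2 hne)).hasDerivAt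

/-- At an interior point the vertical segment just below stays in the region. -/
lemma exists_segment (hsol : IsStefanSolution b T u₀ h s u) {x t t₁ : ℝ} (ht : t ∈ Ioo 0 T)
    (htt : t ≤ t₁) (hx0 : 0 ≤ x) (hx : x < s t) :
    ∃ a < t, ∀ τ ∈ Ioo a t, (x, τ) ∈ stefanD t₁ s := by
  have hev : ∀ᶠ τ in 𝓝 t, 0 < τ ∧ x < s τ :=
    (lt_mem_nhds ht.1).and ((hsol.continuousAt_s ht).eventually (lt_mem_nhds hx))
  obtain ⟨a, ha, hI⟩ := exists_Ioc_subset_of_mem_nhds hev ⟨0, ht.1⟩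
  refine ⟨a, ha, fun τ hτ => ?_⟩
  have := hI ⟨hτ.1, hτ.2.le⟩
  exact ⟨⟨this.1.le, by linarith [hτ.2]⟩, hx0, this.2.le⟩

lemma isCompact_region (hsol : IsStefanSolution b T u₀ h s u) {t₁ : ℝ} (ht₁ : t₁ ≤ T) :
    IsCompact (stefanD t₁ s) :=
  isCompact_stefanD (hsol.continuousOn_s.mono (Icc_subset_Icc le_rfl ht₁))
    fun t ht => hsol.s_pos t ⟨ht.1, ht.2.trans ht₁⟩

lemma nonneg (hsol : IsStefanSolution b T u₀ h s u) (hT : 0 < T) (hb : 0 < b)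
    (hhpos : ∀ t ∈ Icc (0:ℝ) T, 0 < h t) (hu₀c : ContinuousOn u₀ (Icc 0 b))
    (hu₀ : ∀ x ∈ Icc (0:ℝ) b, 0 ≤ u₀ x) {x t : ℝ} (ht : t ∈ Ico 0 T) (hx : x ∈ Icc 0 (s t)) :
    0 ≤ u x t := by
  have hsub : stefanD t s ⊆ stefanD T s := fun z hz => ⟨⟨hz.1.1, hz.1.2.trans ht.2.le⟩, hz.2⟩
  have key : ∀ δ > 0, -u x t - δ * t ≤ 0 := by
    intro δ hδ
    refine nonpos_of_no_pos_max (hsol.isCompact_region ht.2.le)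
      (w := fun z => -u z.1 z.2 - δ * z.2) ?_ ?_ (x, t) ⟨⟨ht.1, le_rfl⟩, hx⟩
    · exact ((hsol.continuousOn_u hT).mono hsub).neg.sub (by fun_prop)
    rintro ⟨X, τ⟩ ⟨hτ, hX⟩ hpos hmax
    simp only at hτ hX hpos
    have hmax' : ∀ y r, (y, r) ∈ stefanD t s → -u y r - δ * r ≤ -u X τ - δ * τ :=
      fun y r hyr => hmax hyr
    have hδτ : 0 ≤ δ * τ := mul_nonneg hδ.le hτ.1
    rcases hτ.1.eq_or_lt with h0 | h0
    · subst h0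
      rw [hsol.s_init] at hX
      rw [hsol.u_initial hT hb hu₀c X hX] at hpos
      linarith [hu₀ X hX]
    have hτI : τ ∈ Ioo 0 T := ⟨h0, hτ.2.trans_lt ht.2⟩
    rcases hX.2.eq_or_lt with h1 | h1
    · rw [h1, hsol.front_zero τ hτI] at hpos
      linarith
    rcases hX.1.eq_or_lt with h2 | h2
    · rw [← h2] at hmax' h1
      have := ((hsol.hasDerivAt_left hhpos hτI).neg.sub_const (δ * τ)).nonpos_of_right_le h1
        fun y hy => hmax' y τ ⟨hτ, hy.1.le, hy.2.le⟩
      linarith [hhpos τ ⟨h0.le, hτI.2.le⟩]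
    have hQ : ∀ y ∈ Ioo 0 (s τ), (y, τ) ∈ stefanQ T s := fun y hy => ⟨hy.1, hy.2, h0, hτI.2⟩
    have hxx := IsLocalMax.second_deriv_nonpos (f := fun y => -u y τ - δ * τ)
      (p := fun y => -deriv (fun z => u z τ) y) (x := X)
      (by filter_upwards [Ioo_mem_nhds h2 h1] with y hy using hmax' y τ ⟨hτ, hy.1.le, hy.2.le⟩)
      (by filter_upwards [Ioo_mem_nhds h2 h1] with y hy
          exact (hsol.u_x y τ (hQ y hy)).neg.sub_const _)
      (hsol.u_xx X τ (hQ X ⟨h2, h1⟩)).neg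
    obtain ⟨a, ha, hseg⟩ := hsol.exists_segment hτI hτ.2 hX.1 h1
    have htt := ((hsol.heat X τ (hQ X ⟨h2, h1⟩)).neg.sub
      ((hasDerivAt_id τ).const_mul δ)).nonneg_of_left_le ha fun r hr => hmax' X r (hseg r hr)
    linarith
  have : Tendsto (fun δ : ℝ => -u x t - δ * t) (𝓝[>] 0) (𝓝 (-u x t - 0 * t)) :=
    (Continuous.tendsto (by fun_prop) 0).mono_left nhdsWithin_le_nhds
  have := le_of_tendsto this (eventually_mem_nhdsWithin.mono key)
  linarith

lemma deriv_s_nonneg (hsol : IsStefanSolution b T u₀ h s u)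
    (hnn : ∀ t ∈ Ico 0 T, ∀ x ∈ Icc 0 (s t), 0 ≤ u x t) {t : ℝ} (ht : t ∈ Ioo 0 T) :
    0 ≤ deriv s t := by
  by_cases hne : deriv s t = 0
  · exact hne.ge
  have h1 := (hsol.hasDerivAt_front ht hne).neg.nonneg_of_left_le
    (hsol.s_pos t ⟨ht.1.le, ht.2.le⟩) fun y hy => by
      simp only [Pi.neg_apply]
      rw [hsol.front_zero t ht]
      linarith [hnn t ⟨ht.1.le, ht.2⟩ y ⟨hy.1.le, hy.2.le⟩]
  simpa using h1

lemma monotoneOn_s (hsol : IsStefanSolution b T u₀ h s u)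
    (hs' : ∀ t ∈ Ioo 0 T, 0 ≤ deriv s t) : MonotoneOn s (Icc 0 T) := by
  refine monotoneOn_of_deriv_nonneg (convex_Icc 0 T) hsol.continuousOn_s ?_ ?_
  · rw [interior_Icc]
    exact fun t ht => (hsol.s_diff t ⟨ht.1, ht.2.le⟩).differentiableAt.differentiableWithinAt
  · rwa [interior_Icc]

lemma le_linear (hsol : IsStefanSolution b T u₀ h s u) (hT : 0 < T) (hb : 0 < b)
    (hhpos : ∀ t ∈ Icc (0:ℝ) T, 0 < h t) (hu₀c : ContinuousOn u₀ (Icc 0 b)) {M : ℝ}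
    (hM : 0 ≤ M) (hhM : ∀ t ∈ Icc (0:ℝ) T, h t ≤ M) (hu₀ : ∀ x ∈ Icc (0:ℝ) b, u₀ x ≤ M * (b - x))
    (hs' : ∀ t ∈ Ioo 0 T, 0 ≤ deriv s t) {x t : ℝ} (ht : t ∈ Ico 0 T) (hx : x ∈ Icc 0 (s t)) :
    u x t ≤ M * (s t - x) := by
  have hsub : stefanD t s ⊆ stefanD T s := fun z hz => ⟨⟨hz.1.1, hz.1.2.trans ht.2.le⟩, hz.2⟩
  have key : ∀ δ > 0, u x t - (M + δ) * (s t - x) - δ * t ≤ 0 := by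
    intro δ hδ
    refine nonpos_of_no_pos_max (hsol.isCompact_region ht.2.le)
      (w := fun z => u z.1 z.2 - (M + δ) * (s z.2 - z.1) - δ * z.2) ?_ ?_ (x, t)
      ⟨⟨ht.1, le_rfl⟩, hx⟩
    · refine (((hsol.continuousOn_u hT).mono hsub).sub (continuousOn_const.mul
        (ContinuousOn.sub ?_ continuousOn_fst))).sub (by fun_prop)
      exact hsol.continuousOn_s.comp continuousOn_snd fun z hz => (hsub hz).1
    rintro ⟨X, τ⟩ ⟨hτ, hX⟩ hpos hmax
    simp only at hτ hX hpos
    have hmax' : ∀ y r, (y, r) ∈ stefanD t s → u y r - (M + δ) * (s r - y) - δ * r ≤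
        u X τ - (M + δ) * (s τ - X) - δ * τ := fun y r hyr => hmax hyr
    have hδτ : 0 ≤ δ * τ := mul_nonneg hδ.le hτ.1
    rcases hτ.1.eq_or_lt with h0 | h0
    · subst h0
      rw [hsol.s_init] at hX hpos
      rw [hsol.u_initial hT hb hu₀c X hX] at hpos
      nlinarith [hu₀ X hX, hX.2]
    have hτI : τ ∈ Ioo 0 T := ⟨h0, hτ.2.trans_lt ht.2⟩
    rcases hX.2.eq_or_lt with h1 | h1
    · rw [h1, hsol.front_zero τ hτI, sub_self] at hpos
      linarith
    have hlin : ∀ y, HasDerivAt (fun y => (M + δ) * (s τ - y)) (-(M + δ)) y := fun y =>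
      (((hasDerivAt_id y).const_sub (s τ)).const_mul (M + δ)).congr_deriv (by ring)
    rcases hX.1.eq_or_lt with h2 | h2
    · rw [← h2] at hmax' h1
      have := (((hsol.hasDerivAt_left hhpos hτI).sub (hlin 0)).sub_const
        (δ * τ)).nonpos_of_right_le h1 fun y hy => hmax' y τ ⟨hτ, hy.1.le, hy.2.le⟩
      linarith [hhM τ ⟨h0.le, hτI.2.le⟩]
    have hQ : ∀ y ∈ Ioo 0 (s τ), (y, τ) ∈ stefanQ T s := fun y hy => ⟨hy.1, hy.2, h0, hτI.2⟩
    have hxx := IsLocalMax.second_deriv_nonpos (f := fun y => u y τ - (M + δ) * (s τ - y) - δ * τ)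
      (p := fun y => deriv (fun z => u z τ) y - -(M + δ)) (x := X)
      (by filter_upwards [Ioo_mem_nhds h2 h1] with y hy using hmax' y τ ⟨hτ, hy.1.le, hy.2.le⟩)
      (by filter_upwards [Ioo_mem_nhds h2 h1] with y hy
          exact ((hsol.u_x y τ (hQ y hy)).sub (hlin y)).sub_const _)
      ((hsol.u_xx X τ (hQ X ⟨h2, h1⟩)).sub_const _)
    obtain ⟨a, ha, hseg⟩ := hsol.exists_segment hτI hτ.2 hX.1 h1
    have htt := (((hsol.heat X τ (hQ X ⟨h2, h1⟩)).sub
      (((hsol.s_diff τ ⟨h0, hτI.2.le⟩).sub_const X).const_mul (M + δ))).sub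
      ((hasDerivAt_id τ).const_mul δ)).nonneg_of_left_le ha fun r hr => hmax' X r (hseg r hr)
    have := mul_nonneg (by linarith : 0 ≤ M + δ) (hs' τ hτI)
    linarith
  have : Tendsto (fun δ : ℝ => u x t - (M + δ) * (s t - x) - δ * t) (𝓝[>] 0)
      (𝓝 (u x t - (M + 0) * (s t - x) - 0 * t)) :=
    (Continuous.tendsto (by fun_prop) 0).mono_left nhdsWithin_le_nhds
  have := le_of_tendsto this (eventually_mem_nhdsWithin.mono key)
  simp at this
  linarith

lemma deriv_s_le (hsol : IsStefanSolution b T u₀ h s u) {M : ℝ} (hM : 0 ≤ M)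
    (hle : ∀ t ∈ Ico 0 T, ∀ x ∈ Icc 0 (s t), u x t ≤ M * (s t - x)) {t : ℝ} (ht : t ∈ Ioo 0 T) :
    deriv s t ≤ M := by
  by_cases hne : deriv s t = 0
  · rwa [hne]
  have hlin : HasDerivAt (fun y => M * (s t - y)) (-M) (s t) :=
    (((hasDerivAt_id (s t)).const_sub (s t)).const_mul M).congr_deriv (by ring)
  have h1 := ((hsol.hasDerivAt_front ht hne).sub hlin).nonneg_of_left_le
    (hsol.s_pos t ⟨ht.1.le, ht.2.le⟩) fun y hy => by
      simp only [Pi.sub_apply]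
      rw [hsol.front_zero t ht]
      linarith [hle t ⟨ht.1.le, ht.2⟩ y ⟨hy.1.le, hy.2.le⟩]
  linarith

/-- Uniform one-sided Lipschitz bound at the fixed boundary, away from the initial time. -/
lemma exists_left_lipschitz (hsol : IsStefanSolution b T u₀ h s u) (hT : 0 < T) (hb : 0 < b)
    (hhpos : ∀ t ∈ Icc (0:ℝ) T, 0 < h t) {m A : ℝ} (hhm : ∀ t ∈ Icc (0:ℝ) T, h t ≤ m)
    (hA : 0 < A) (hbd : ∀ t ∈ Ico 0 T, ∀ x ∈ Icc 0 (s t), |u x t| ≤ A)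
    (hsb : ∀ t ∈ Icc 0 T, b ≤ s t) {t₁ : ℝ} (ht₁ : 0 < t₁) :
    ∃ C, ∀ t ∈ Ico t₁ T, ∀ x ∈ Icc 0 b, u 0 t - u x t ≤ C * x := by
  obtain ⟨K, hK⟩ : ∃ K, K = 2 * A / b ^ 2 + A / (t₁ / 2) := ⟨_, rfl⟩
  have hm : 0 < m := (hhpos 0 ⟨le_rfl, hT.le⟩).trans_le (hhm 0 ⟨le_rfl, hT.le⟩)
  refine ⟨4 * K * b + m + 1 + 2 * A / b, fun t ht x hx => ?_⟩
  have hmem : ∀ τ ∈ Icc (t - t₁ / 2) t, τ ∈ Ioo 0 T := fun τ hτ =>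
    ⟨by linarith [hτ.1, ht.1], by linarith [hτ.2, ht.2]⟩
  have := (hsol.heatOn (α := 0) (β := b) (t₀ := t - t₁ / 2) (t₁ := t) le_rfl (by linarith [ht.1])
    ht.2 fun τ hτ => hsb τ ⟨(hmem τ ⟨hτ.1.le, hτ.2⟩).1.le, (hmem τ ⟨hτ.1.le, hτ.2⟩).2.le⟩).sub_le
    (x₀ := 0) (r := b) (A := A) (K := K) (C := 4 * K * b + m + 1) hb (by linarith) hA
    (by rw [sub_sub_cancel, hK]) (by linarith) (by ring) ?_ ?_ (Or.inr ⟨rfl, fun τ hτ => ?_⟩) x hx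
  · simpa using this
  · refine (hsol.continuousOn_u hT).mono fun z hz => ?_
    have h1 := hmem _ hz.2
    have h2 : z.2 ∈ Icc 0 T := ⟨h1.1.le, h1.2.le⟩
    exact ⟨h2, hz.1.1, hz.1.2.trans (hsb _ h2)⟩
  · intro y hy τ hτ
    have h1 := hmem _ hτ
    exact hbd τ ⟨h1.1.le, h1.2⟩ y ⟨hy.1, hy.2.trans (hsb τ ⟨h1.1.le, h1.2.le⟩)⟩
  · have h1 := hmem τ ⟨hτ.1.le, hτ.2⟩
    exact ⟨-h τ, hsol.hasDerivAt_left hhpos h1, by linarith [hhm τ ⟨h1.1.le, h1.2.le⟩]⟩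

end IsStefanSolution

/-- The trapezoidal weight `min (z - a) ε (c - z)` integrates a function with values in `[0, N]`
to something between `0` and `ε * N * (c - a)`. -/
lemma trapezoid_bounds {f : ℝ → ℝ} {a c ε N : ℝ} (hε : 0 < ε) (hac : a + ε ≤ c - ε)
    (hf : ContinuousOn f (Icc a c)) (h0 : ∀ z ∈ Icc a c, 0 ≤ f z) (hN : ∀ z ∈ Icc a c, f z ≤ N) :
    let I := (∫ z in a..c, (c - z) * f z) - (∫ z in a..c - ε, (c - ε - z) * f z) -
      ∫ z in a..a + ε, (a + ε - z) * f z
    0 ≤ I ∧ I ≤ ε * N * (c - a) := by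
  intro I
  have hi : ∀ w : ℝ → ℝ, Continuous w → ∀ x ∈ Icc a c, ∀ y ∈ Icc a c,
      IntervalIntegrable (fun z => w z * f z) volume x y := fun w hw x hx y hy =>
    (hw.continuousOn.mul (hf.mono (uIcc_subset_Icc hx hy))).intervalIntegrable
  have ma : a ∈ Icc a c := ⟨le_rfl, by linarith⟩
  have mc : c ∈ Icc a c := ⟨by linarith, le_rfl⟩
  have ma' : a + ε ∈ Icc a c := ⟨by linarith, by linarith⟩
  have mc' : c - ε ∈ Icc a c := ⟨by linarith, by linarith⟩
  have hI : I = (∫ z in a..a + ε, (z - a) * f z) + (∫ z in a + ε..c - ε, ε * f z) +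
      ∫ z in c - ε..c, (c - z) * f z := by
    have e1 := intervalIntegral.integral_add_adjacent_intervals
      (hi (fun z => c - z) (by fun_prop) a ma (c - ε) mc')
      (hi (fun z => c - z) (by fun_prop) (c - ε) mc' c mc)
    have e2 := intervalIntegral.integral_sub (hi (fun z => c - z) (by fun_prop) a ma (c - ε) mc')
      (hi (fun z => c - ε - z) (by fun_prop) a ma (c - ε) mc')
    have e3 : ∀ z, (c - z) * f z - (c - ε - z) * f z = ε * f z := fun z => by ring
    simp only [e3] at e2
    have e4 := intervalIntegral.integral_add_adjacent_intervals
      (hi (fun _ => ε) (by fun_prop) a ma (a + ε) ma')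
      (hi (fun _ => ε) (by fun_prop) (a + ε) ma' (c - ε) mc')
    have e5 := intervalIntegral.integral_sub (hi (fun _ => ε) (by fun_prop) a ma (a + ε) ma')
      (hi (fun z => a + ε - z) (by fun_prop) a ma (a + ε) ma')
    have e6 : ∀ z, ε * f z - (a + ε - z) * f z = (z - a) * f z := fun z => by ring
    simp only [e6] at e5
    simp only [I]
    linarith
  have hb : ∀ w : ℝ → ℝ, Continuous w → ∀ x ∈ Icc a c, ∀ y ∈ Icc a c, x ≤ y →
      (∀ z ∈ Icc x y, 0 ≤ w z ∧ w z ≤ ε) →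
      0 ≤ (∫ z in x..y, w z * f z) ∧ (∫ z in x..y, w z * f z) ≤ ε * N * (y - x) := by
    intro w hw x hx y hy hxy hwb
    have hm : ∀ z ∈ Icc x y, z ∈ Icc a c := fun z hz => ⟨hx.1.trans hz.1, hz.2.trans hy.2⟩
    refine ⟨intervalIntegral.integral_nonneg hxy fun z hz =>
      mul_nonneg (hwb z hz).1 (h0 z (hm z hz)), ?_⟩
    have := intervalIntegral.integral_mono_on hxy (hi w hw x hx y hy)
      (intervalIntegrable_const (c := ε * N)) fun z hz =>
        mul_le_mul (hwb z hz).2 (hN z (hm z hz)) (h0 z (hm z hz)) hε.le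
    rw [intervalIntegral.integral_const, smul_eq_mul] at this
    linarith
  have b1 := hb (fun z => z - a) (by fun_prop) a ma (a + ε) ma' (by linarith)
    fun z hz => ⟨by linarith [hz.1], by linarith [hz.2]⟩
  have b2 := hb (fun _ => ε) (by fun_prop) (a + ε) ma' (c - ε) mc' hac fun z hz => ⟨hε.le, le_rfl⟩
  have b3 := hb (fun z => c - z) (by fun_prop) (c - ε) mc' c mc (by linarith)
    fun z hz => ⟨by linarith [hz.2], by linarith [hz.1]⟩
  rw [hI]
  constructor
  · linarith [b1.1, b2.1, b3.1]
  · have : ε * N * (c - a) = ε * N * (a + ε - a) + ε * N * (c - ε - (a + ε)) +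
      ε * N * (c - (c - ε)) := by ring
    linarith [b1.2, b2.2, b3.2]

namespace IsStefanSolution

variable {b T : ℝ} {u₀ h s : ℝ → ℝ} {u : ℝ → ℝ → ℝ}

lemma continuousOn_u_comp (hsol : IsStefanSolution b T u₀ h s u) (hT : 0 < T) {t₁ t₂ : ℝ}
    (ht₁ : 0 ≤ t₁) (ht₂ : t₂ ≤ T) {c : ℝ → ℝ} (hc : ContinuousOn c (Icc t₁ t₂))
    (hcm : ∀ t ∈ Icc t₁ t₂, c t ∈ Icc 0 (s t)) : ContinuousOn (fun t => u (c t) t) (Icc t₁ t₂) :=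
  (hsol.continuousOn_u hT).comp (f := fun t => (c t, t)) (hc.prodMk continuousOn_id)
    fun t ht => ⟨⟨ht₁.trans ht.1, ht.2.trans ht₂⟩, hcm t ht⟩

lemma continuousOn_u_slice (hsol : IsStefanSolution b T u₀ h s u) (hT : 0 < T) {t : ℝ}
    (ht : t ∈ Icc 0 T) : ContinuousOn (fun x => u x t) (Icc 0 (s t)) :=
  (hsol.continuousOn_u hT).comp (f := fun x => (x, t)) (by fun_prop) fun _ hx => ⟨ht, hx⟩

/-- Approximate mass balance, with the flux at both ends replaced by difference quotients taken at
distance `δ` from the boundary. -/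
lemma flux_integral_le_aux (hsol : IsStefanSolution b T u₀ h s u) {M N δ ε t₁ t₂ : ℝ}
    (hM : 0 ≤ M) (hnn : ∀ t ∈ Ico 0 T, ∀ x ∈ Icc 0 (s t), 0 ≤ u x t)
    (hle : ∀ t ∈ Ico 0 T, ∀ x ∈ Icc 0 (s t), u x t ≤ M * (s t - x))
    (hs0 : ∀ t ∈ Ioo 0 T, 0 ≤ deriv s t) (hsM : ∀ t ∈ Ioo 0 T, deriv s t ≤ M)
    (hsb : ∀ t ∈ Icc 0 T, b ≤ s t) (ht₁ : 0 < t₁) (h12 : t₁ ≤ t₂) (ht₂ : t₂ < T)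
    (hN0 : 0 ≤ N) (hN : ∀ x ∈ Icc 0 (s t₁), u x t₁ ≤ N) (hδ : 0 < δ) (hε : 0 < ε)
    (hδε : 2 * δ + 2 * ε ≤ b) :
    ∫ t in t₁..t₂, (u (s t - δ - ε) t - u (s t - δ) t + u (δ + ε) t - u δ t) ≤
      ε * N * s t₁ + M * (M * (δ + ε) * ε) * (t₂ - t₁) := by
  have hT : 0 < T := by linarith
  have hmem : ∀ t ∈ Icc t₁ t₂, t ∈ Ioo 0 T := fun t ht => ⟨by linarith [ht.1], by linarith [ht.2]⟩
  have hsb' : ∀ t ∈ Icc t₁ t₂, b ≤ s t := fun t ht => hsb t ⟨(hmem t ht).1.le, (hmem t ht).2.le⟩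
  have hsc : ContinuousOn s (Icc t₁ t₂) :=
    hsol.continuousOn_s.mono (Icc_subset_Icc ht₁.le ht₂.le)
  let I : ℝ → ℝ := fun t => (∫ z in δ..s t - δ, (s t - δ - z) * u z t) -
    (∫ z in δ..s t - δ - ε, (s t - δ - ε - z) * u z t) - ∫ z in δ..δ + ε, (δ + ε - z) * u z t
  have hI : ∀ t ∈ Icc t₁ t₂, HasDerivAt I (u (s t - δ) t - u (s t - δ - ε) t - u (δ + ε) t + u δ t
      + deriv s t * ((∫ z in δ..s t - δ, u z t) - ∫ z in δ..s t - δ - ε, u z t)) t := by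
    intro t ht
    have htI := hmem t ht
    have hev : ∀ᶠ τ in 𝓝 t, (0 < τ ∧ τ < T) ∧ s t - δ / 2 < s τ :=
      ((lt_mem_nhds htI.1).and (gt_mem_nhds htI.2)).and
        ((hsol.continuousAt_s htI).eventually (lt_mem_nhds (by linarith)))
    obtain ⟨ρ, hρ, hball⟩ := Metric.eventually_nhds_iff.1 hev
    have hball' : ∀ τ ∈ Icc (t - ρ / 2) (t + ρ / 2), (0 < τ ∧ τ < T) ∧ s t - δ / 2 < s τ := by
      intro τ hτ
      refine hball ?_
      rw [Real.dist_eq, abs_lt]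
      constructor <;> linarith [hτ.1, hτ.2]
    have hheat := hsol.heatOn (α := δ / 2) (β := s t - δ / 2) (t₀ := t - ρ / 2) (t₁ := t + ρ / 2)
      (by linarith) (hball' (t - ρ / 2) ⟨le_rfl, by linarith⟩).1.1.le
      (hball' (t + ρ / 2) ⟨by linarith, le_rfl⟩).1.2
      fun τ hτ => (hball' τ ⟨hτ.1.le, hτ.2⟩).2.le
    have hv : ContinuousOn (fun z : ℝ × ℝ => u z.1 z.2)
        (Icc (δ / 2) (s t - δ / 2) ×ˢ Icc (t - ρ / 2) (t + ρ / 2)) := by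
      refine (hsol.continuousOn_u hT).mono fun z hz => ?_
      have h1 := hball' _ hz.2
      exact ⟨⟨h1.1.1.le, h1.1.2.le⟩, by linarith [hz.1.1], by linarith [hz.1.2, h1.2]⟩
    have htρ : t ∈ Ioo (t - ρ / 2) (t + ρ / 2) := ⟨by linarith, by linarith⟩
    have hst := hsb' t ht
    have hsd := (hsol.s_diff t ⟨htI.1, htI.2.le⟩).sub_const δ
    have d1 := hheat.hasDerivAt_double_integral hv (a := δ) (c := fun t => s t - δ) (by linarith)
      (by linarith) (by linarith) htρ hsd
    have d2 := hheat.hasDerivAt_double_integral hv (a := δ) (c := fun t => s t - δ - ε)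
      (by linarith) (by linarith) (by linarith) htρ (hsd.sub_const ε)
    have d3 := hheat.hasDerivAt_double_integral hv (a := δ) (c := fun _ => δ + ε)
      (by linarith) (by linarith) (by linarith) htρ (hasDerivAt_const t (δ + ε))
    exact ((d1.sub d2).sub d3).congr_deriv (by ring)
  have hIb : ∀ t ∈ Icc t₁ t₂, ∀ N, (∀ x ∈ Icc 0 (s t), u x t ≤ N) →
      0 ≤ I t ∧ I t ≤ ε * N * (s t - δ - δ) := by
    intro t ht N hN
    have htI := hmem t ht
    have hst := hsb' t ht
    have hm : ∀ z ∈ Icc δ (s t - δ), z ∈ Icc 0 (s t) := fun z hz =>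
      ⟨by linarith [hz.1], by linarith [hz.2]⟩
    exact trapezoid_bounds hε (by linarith)
      ((hsol.continuousOn_u_slice hT ⟨htI.1.le, htI.2.le⟩).mono hm)
      (fun z hz => hnn t ⟨htI.1.le, htI.2⟩ z (hm z hz)) fun z hz => hN z (hm z hz)
  have hφc : ContinuousOn (fun t => u (s t - δ - ε) t - u (s t - δ) t + u (δ + ε) t - u δ t)
      (Icc t₁ t₂) := by
    refine ((ContinuousOn.sub ?_ ?_).add ?_).sub ?_ <;>
    · refine hsol.continuousOn_u_comp hT ht₁.le ht₂.le (by fun_prop) fun t ht => ?_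
      have := hsb' t ht
      constructor <;> linarith
  have hκ : ∀ t ∈ Icc t₁ t₂,
      deriv s t * ((∫ z in δ..s t - δ, u z t) - ∫ z in δ..s t - δ - ε, u z t) ≤
        M * (M * (δ + ε) * ε) := by
    intro t ht
    have htI := hmem t ht
    have hst := hsb' t ht
    have huc := hsol.continuousOn_u_slice hT ⟨htI.1.le, htI.2.le⟩
    have hint : ∀ x ∈ Icc 0 (s t), ∀ y ∈ Icc 0 (s t),
        IntervalIntegrable (fun z => u z t) volume x y := fun x hx y hy =>
      (huc.mono (uIcc_subset_Icc hx hy)).intervalIntegrable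
    have m1 : δ ∈ Icc 0 (s t) := ⟨by linarith, by linarith⟩
    have m2 : s t - δ ∈ Icc 0 (s t) := ⟨by linarith, by linarith⟩
    have m3 : s t - δ - ε ∈ Icc 0 (s t) := ⟨by linarith, by linarith⟩
    rw [intervalIntegral.integral_interval_sub_left (hint _ m1 _ m2) (hint _ m1 _ m3)]
    have hle' : ∫ z in s t - δ - ε..s t - δ, u z t ≤ M * (δ + ε) * ε := by
      have := intervalIntegral.integral_mono_on (by linarith) (hint _ m3 _ m2)
        (intervalIntegrable_const (c := M * (δ + ε))) fun z hz =>
          (hle t ⟨htI.1.le, htI.2⟩ z ⟨by linarith [hz.1], by linarith [hz.2]⟩).trans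
            (mul_le_mul_of_nonneg_left (by linarith [hz.1]) hM)
      rw [intervalIntegral.integral_const, smul_eq_mul] at this
      linarith
    calc deriv s t * ∫ z in s t - δ - ε..s t - δ, u z t
        ≤ deriv s t * (M * (δ + ε) * ε) := mul_le_mul_of_nonneg_left hle' (hs0 t htI)
      _ ≤ M * (M * (δ + ε) * ε) := mul_le_mul_of_nonneg_right (hsM t htI) (by positivity)
  have hmain := intervalIntegral.sub_le_integral_of_hasDeriv_right_of_le (g := I) h12
    (φ := fun t => M * (M * (δ + ε) * ε) -
      (u (s t - δ - ε) t - u (s t - δ) t + u (δ + ε) t - u δ t))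
    (fun t ht => (hI t ht).continuousAt.continuousWithinAt)
    (fun t ht => (hI t (Ioo_subset_Icc_self ht)).hasDerivWithinAt)
    (continuousOn_const.sub hφc).integrableOn_Icc
    (fun t ht => by linarith [hκ t (Ioo_subset_Icc_self ht)])
  rw [intervalIntegral.integral_sub intervalIntegrable_const
    (hφc.intervalIntegrable_of_Icc h12), intervalIntegral.integral_const, smul_eq_mul] at hmain
  have h1 := (hIb t₁ ⟨le_rfl, h12⟩ N hN).2
  have h2 : 0 ≤ I t₂ := (hIb t₂ ⟨h12, le_rfl⟩ (M * s t₂) fun x hx =>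
    (hle t₂ ⟨by linarith, ht₂⟩ x hx).trans (mul_le_mul_of_nonneg_left (by linarith [hx.1]) hM)).1
  have h3 : 0 ≤ ε * N * δ := by positivity
  linarith

/-- Approximate mass balance up to the boundary. -/
lemma flux_integral_le (hsol : IsStefanSolution b T u₀ h s u) {M N ε t₁ t₂ : ℝ}
    (hM : 0 ≤ M) (hnn : ∀ t ∈ Ico 0 T, ∀ x ∈ Icc 0 (s t), 0 ≤ u x t)
    (hle : ∀ t ∈ Ico 0 T, ∀ x ∈ Icc 0 (s t), u x t ≤ M * (s t - x))
    (hs0 : ∀ t ∈ Ioo 0 T, 0 ≤ deriv s t) (hsM : ∀ t ∈ Ioo 0 T, deriv s t ≤ M)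
    (hsb : ∀ t ∈ Icc 0 T, b ≤ s t) (ht₁ : 0 < t₁) (h12 : t₁ ≤ t₂) (ht₂ : t₂ < T)
    (hN0 : 0 ≤ N) (hN : ∀ x ∈ Icc 0 (s t₁), u x t₁ ≤ N) (hε : 0 < ε) (hεb : 2 * ε < b) :
    ∫ t in t₁..t₂, (u (s t - ε) t + u ε t - u 0 t) ≤
      ε * N * s t₁ + M * (M * ε * ε) * (t₂ - t₁) := by
  have hT : 0 < T := by linarith
  have hmem : ∀ t ∈ Icc t₁ t₂, t ∈ Ioo 0 T := fun t ht => ⟨by linarith [ht.1], by linarith [ht.2]⟩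
  have hsb' : ∀ t ∈ Icc t₁ t₂, b ≤ s t := fun t ht => hsb t ⟨(hmem t ht).1.le, (hmem t ht).2.le⟩
  have hsc : ContinuousOn s (Icc t₁ t₂) :=
    hsol.continuousOn_s.mono (Icc_subset_Icc ht₁.le ht₂.le)
  have hsT := hsol.monotoneOn_s hs0
  have hu : ∀ t ∈ Icc t₁ t₂, ∀ x ∈ Icc 0 (s t), |u x t| ≤ M * s T := by
    intro t ht x hx
    have htI := hmem t ht
    rw [abs_of_nonneg (hnn t ⟨htI.1.le, htI.2⟩ x hx)]
    refine (hle t ⟨htI.1.le, htI.2⟩ x hx).trans (mul_le_mul_of_nonneg_left ?_ hM)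
    linarith [hx.1, hsT ⟨htI.1.le, htI.2.le⟩ ⟨hT.le, le_rfl⟩ htI.2.le]
  have hδ : ∀ᶠ δ : ℝ in 𝓝[>] 0, 0 < δ ∧ 2 * δ + 2 * ε ≤ b := by
    filter_upwards [Ioo_mem_nhdsGT (show 0 < (b - 2 * ε) / 2 by linarith)] with δ hδ
    exact ⟨hδ.1, by linarith [hδ.2]⟩
  have hlim : Tendsto (fun δ => ∫ t in t₁..t₂,
      (u (s t - δ - ε) t - u (s t - δ) t + u (δ + ε) t - u δ t)) (𝓝[>] 0)
      (𝓝 (∫ t in t₁..t₂, (u (s t - ε) t + u ε t - u 0 t))) := by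
    refine intervalIntegral.tendsto_integral_filter_of_dominated_convergence
      (fun _ => 4 * (M * s T)) ?_ ?_ intervalIntegrable_const ?_
    · filter_upwards [hδ] with δ hδ
      refine ContinuousOn.aestronglyMeasurable ?_ measurableSet_uIoc
      refine ContinuousOn.mono (s := Icc t₁ t₂) ?_ (by
        rw [uIoc_of_le h12]; exact Ioc_subset_Icc_self)
      refine ((ContinuousOn.sub ?_ ?_).add ?_).sub ?_ <;>
      · refine hsol.continuousOn_u_comp hT ht₁.le ht₂.le (by fun_prop) fun t ht => ?_
        have := hsb' t ht
        constructor <;> linarith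
    · filter_upwards [hδ] with δ hδ
      refine Eventually.of_forall fun t ht => ?_
      rw [uIoc_of_le h12] at ht
      have ht' : t ∈ Icc t₁ t₂ := ⟨ht.1.le, ht.2⟩
      have hst := hsb' t ht'
      have a1 := abs_le.1 (hu t ht' (s t - δ - ε) ⟨by linarith, by linarith⟩)
      have a2 := abs_le.1 (hu t ht' (s t - δ) ⟨by linarith, by linarith⟩)
      have a3 := abs_le.1 (hu t ht' (δ + ε) ⟨by linarith, by linarith⟩)
      have a4 := abs_le.1 (hu t ht' δ ⟨by linarith, by linarith⟩)
      rw [Real.norm_eq_abs, abs_le]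
      constructor <;> linarith
    · refine Eventually.of_forall fun t ht => ?_
      rw [uIoc_of_le h12] at ht
      have ht' : t ∈ Icc t₁ t₂ := ⟨ht.1.le, ht.2⟩
      have hst := hsb' t ht'
      have htI := hmem t ht'
      have hsl := hsol.continuousOn_u_slice hT ⟨htI.1.le, htI.2.le⟩
      have hcomp : ∀ c : ℝ → ℝ, Continuous c → c 0 ∈ Icc 0 (s t) →
          (∀ᶠ δ in 𝓝[>] 0, c δ ∈ Icc 0 (s t)) →
          Tendsto (fun δ => u (c δ) t) (𝓝[>] 0) (𝓝 (u (c 0) t)) := fun c hc h0 hcm =>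
        (hsl (c 0) h0).tendsto.comp (tendsto_nhdsWithin_iff.2
          ⟨(hc.tendsto 0).mono_left nhdsWithin_le_nhds, hcm⟩)
      have l1 := hcomp (fun δ => s t - δ - ε) (by fun_prop) ⟨by linarith, by linarith⟩
        (hδ.mono fun δ hδ => ⟨by linarith, by linarith⟩)
      have l2 := hcomp (fun δ => s t - δ) (by fun_prop) ⟨by linarith, by linarith⟩
        (hδ.mono fun δ hδ => ⟨by linarith, by linarith⟩)
      have l3 := hcomp (fun δ => δ + ε) (by fun_prop) ⟨by linarith, by linarith⟩
        (hδ.mono fun δ hδ => ⟨by linarith, by linarith⟩)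
      have l4 := hcomp (fun δ => δ) (by fun_prop) ⟨by linarith, by linarith⟩
        (hδ.mono fun δ hδ => ⟨by linarith, by linarith⟩)
      have := ((l1.sub l2).add l3).sub l4
      simpa only [sub_zero, zero_add, hsol.front_zero t htI] using this
  have hR : Tendsto (fun δ : ℝ => ε * N * s t₁ + M * (M * (δ + ε) * ε) * (t₂ - t₁)) (𝓝[>] 0)
      (𝓝 (ε * N * s t₁ + M * (M * (0 + ε) * ε) * (t₂ - t₁))) :=
    (Continuous.tendsto (by fun_prop) 0).mono_left nhdsWithin_le_nhds
  rw [zero_add] at hR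
  exact le_of_tendsto_of_tendsto hlim hR (hδ.mono fun δ hδ =>
    hsol.flux_integral_le_aux hM hnn hle hs0 hsM hsb ht₁ h12 ht₂ hN0 hN hδ.1 hε hδ.2)

lemma front_sub_le (hsol : IsStefanSolution b T u₀ h s u) {M N m C t₁ t₂ : ℝ} (hb : 0 < b)
    (hM : 0 ≤ M) (hm : 0 ≤ m) (hhm : ∀ t ∈ Icc (0:ℝ) T, h t ≤ m)
    (hhpos : ∀ t ∈ Icc (0:ℝ) T, 0 < h t)
    (hnn : ∀ t ∈ Ico 0 T, ∀ x ∈ Icc 0 (s t), 0 ≤ u x t)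
    (hle : ∀ t ∈ Ico 0 T, ∀ x ∈ Icc 0 (s t), u x t ≤ M * (s t - x))
    (hs0 : ∀ t ∈ Ioo 0 T, 0 ≤ deriv s t) (hsM : ∀ t ∈ Ioo 0 T, deriv s t ≤ M)
    (hsb : ∀ t ∈ Icc 0 T, b ≤ s t) (ht₁ : 0 < t₁) (h12 : t₁ ≤ t₂) (ht₂ : t₂ < T)
    (hC : ∀ t ∈ Ico t₁ T, ∀ x ∈ Icc 0 b, u 0 t - u x t ≤ C * x)
    (hN0 : 0 ≤ N) (hN : ∀ x ∈ Icc 0 (s t₁), u x t₁ ≤ N) :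
    s t₂ - s t₁ ≤ m * (t₂ - t₁) + N * s t₁ := by
  have hT : 0 < T := by linarith
  have hmem : ∀ t ∈ Icc t₁ t₂, t ∈ Ioo 0 T := fun t ht => ⟨by linarith [ht.1], by linarith [ht.2]⟩
  have hsb' : ∀ t ∈ Icc t₁ t₂, b ≤ s t := fun t ht => hsb t ⟨(hmem t ht).1.le, (hmem t ht).2.le⟩
  have hsc : ContinuousOn s (Icc t₁ t₂) :=
    hsol.continuousOn_s.mono (Icc_subset_Icc ht₁.le ht₂.le)
  have hs'c : ContinuousOn (deriv s) (Icc t₁ t₂) :=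
    hsol.s_deriv_cont.mono fun t ht => ⟨(hmem t ht).1, (hmem t ht).2.le⟩
  let k : ℝ → ℝ → ℝ := fun ε t =>
    min (u (s t - ε) t / ε) (deriv s t) - max ((u 0 t - u ε t) / ε) m
  have hε : ∀ᶠ ε : ℝ in 𝓝[>] 0, 0 < ε ∧ 2 * ε < b := by
    filter_upwards [Ioo_mem_nhdsGT (show 0 < b / 2 by linarith)] with ε hε
    exact ⟨hε.1, by linarith [hε.2]⟩
  have huc : ∀ ε, 0 < ε ∧ 2 * ε < b → ContinuousOn (fun t => u (s t - ε) t) (Icc t₁ t₂) ∧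
      ContinuousOn (fun t => u ε t) (Icc t₁ t₂) ∧ ContinuousOn (fun t => u 0 t) (Icc t₁ t₂) := by
    intro ε hε
    refine ⟨?_, ?_, ?_⟩ <;>
    · refine hsol.continuousOn_u_comp hT ht₁.le ht₂.le (by fun_prop) fun t ht => ?_
      have := hsb' t ht
      constructor <;> linarith
  have hkc : ∀ ε, 0 < ε ∧ 2 * ε < b → ContinuousOn (k ε) (Icc t₁ t₂) := by
    intro ε hε
    obtain ⟨c1, c2, c3⟩ := huc ε hε
    exact ((c1.div_const ε).inf hs'c).sub (((c3.sub c2).div_const ε).sup continuousOn_const)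
  have hkle : ∀ᶠ ε in 𝓝[>] 0, ∫ t in t₁..t₂, k ε t ≤ N * s t₁ + M * (M * ε) * (t₂ - t₁) := by
    filter_upwards [hε] with ε hε
    obtain ⟨c1, c2, c3⟩ := huc ε hε
    have h1 := hsol.flux_integral_le hM hnn hle hs0 hsM hsb ht₁ h12 ht₂ hN0 hN hε.1 hε.2
    have h2 : ∫ t in t₁..t₂, k ε t ≤ ∫ t in t₁..t₂, (u (s t - ε) t + u ε t - u 0 t) / ε := by
      refine intervalIntegral.integral_mono_on h12 ((hkc ε hε).intervalIntegrable_of_Icc h12)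
        ((((c1.add c2).sub c3).div_const ε).intervalIntegrable_of_Icc h12) fun t _ => ?_
      have e : (u (s t - ε) t + u ε t - u 0 t) / ε =
        u (s t - ε) t / ε - (u 0 t - u ε t) / ε := by ring
      rw [e]
      exact sub_le_sub (min_le_left _ _) (le_max_left _ _)
    rw [intervalIntegral.integral_div] at h2
    refine h2.trans ((div_le_iff₀ hε.1).2 (h1.trans (le_of_eq ?_)))
    ring
  have hlim : Tendsto (fun ε => ∫ t in t₁..t₂, k ε t) (𝓝[>] 0)
      (𝓝 (∫ t in t₁..t₂, (deriv s t - m))) := by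
    refine intervalIntegral.tendsto_integral_filter_of_dominated_convergence
      (fun _ => M + (|C| + m)) ?_ ?_ intervalIntegrable_const ?_
    · filter_upwards [hε] with ε hε
      exact ((hkc ε hε).mono (by
        rw [uIoc_of_le h12]; exact Ioc_subset_Icc_self)).aestronglyMeasurable measurableSet_uIoc
    · filter_upwards [hε] with ε hε
      refine Eventually.of_forall fun t ht => ?_
      rw [uIoc_of_le h12] at ht
      have ht' : t ∈ Icc t₁ t₂ := ⟨ht.1.le, ht.2⟩
      have hst := hsb' t ht'
      have htI := hmem t ht'
      have b1 : 0 ≤ min (u (s t - ε) t / ε) (deriv s t) := le_min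
        (div_nonneg (hnn t ⟨htI.1.le, htI.2⟩ _ ⟨by linarith, by linarith⟩) hε.1.le) (hs0 t htI)
      have b2 : min (u (s t - ε) t / ε) (deriv s t) ≤ M := (min_le_right _ _).trans (hsM t htI)
      have b3 : 0 ≤ max ((u 0 t - u ε t) / ε) m := hm.trans (le_max_right _ _)
      have b4 : max ((u 0 t - u ε t) / ε) m ≤ |C| + m := by
        refine max_le ?_ (by linarith [abs_nonneg C])
        have : (u 0 t - u ε t) / ε ≤ C := (div_le_iff₀ hε.1).2
          (hC t ⟨ht.1.le, htI.2⟩ ε ⟨hε.1.le, by linarith⟩)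
        linarith [le_abs_self C]
      rw [Real.norm_eq_abs, abs_le]
      simp only [k]
      constructor <;> linarith [abs_nonneg C]
    · refine Eventually.of_forall fun t ht => ?_
      rw [uIoc_of_le h12] at ht
      have ht' : t ∈ Icc t₁ t₂ := ⟨ht.1.le, ht.2⟩
      have hst := hsb' t ht'
      have htI := hmem t ht'
      have hr : Tendsto (fun ε => max ((u 0 t - u ε t) / ε) m) (𝓝[>] 0) (𝓝 m) := by
        have h1 : Tendsto (fun ε => (u 0 t - u ε t) / ε) (𝓝[>] 0) (𝓝 (h t)) := by
          have h2 := (hsol.hasDerivAt_left hhpos htI).tendsto_slope_zero_right.neg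
          rw [neg_neg] at h2
          refine h2.congr fun ε => ?_
          rw [smul_eq_mul, zero_add]; ring
        have h3 := h1.max (tendsto_const_nhds (x := m))
        rwa [max_eq_right (hhm t ⟨htI.1.le, htI.2.le⟩)] at h3
      have hl : Tendsto (fun ε => min (u (s t - ε) t / ε) (deriv s t)) (𝓝[>] 0)
          (𝓝 (deriv s t)) := by
        by_cases hne : deriv s t = 0
        · refine tendsto_const_nhds.congr' ?_
          filter_upwards [hε] with ε hε
          rw [hne, min_eq_right]
          exact div_nonneg (hnn t ⟨htI.1.le, htI.2⟩ _ ⟨by linarith, by linarith⟩) hε.1.le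
        · have hd : HasDerivAt (fun ε => u (s t - ε) t) (deriv s t) 0 := by
            have h1 : HasDerivAt (fun ε : ℝ => s t - ε) (-1) 0 := (hasDerivAt_id 0).const_sub (s t)
            have h2 := hsol.hasDerivAt_front htI hne
            rw [← sub_zero (s t)] at h2
            have h3 := h2.comp (0:ℝ) h1
            refine h3.congr_deriv ?_
            ring
          have h1 := hd.tendsto_slope_zero_right
          have h2 : Tendsto (fun ε => u (s t - ε) t / ε) (𝓝[>] 0) (𝓝 (deriv s t)) := by
            refine h1.congr fun ε => ?_
            rw [smul_eq_mul, zero_add, sub_zero, hsol.front_zero t htI]; ring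
          simpa using h2.min (tendsto_const_nhds (x := deriv s t))
      exact hl.sub hr
  have hR : Tendsto (fun ε : ℝ => N * s t₁ + M * (M * ε) * (t₂ - t₁)) (𝓝[>] 0)
      (𝓝 (N * s t₁ + M * (M * 0) * (t₂ - t₁))) :=
    (Continuous.tendsto (by fun_prop) 0).mono_left nhdsWithin_le_nhds
  have hfin := le_of_tendsto_of_tendsto hlim hR hkle
  have hsi := hs'c.intervalIntegrable_of_Icc (μ := volume) h12
  rw [intervalIntegral.integral_sub hsi intervalIntegrable_const,
    intervalIntegral.integral_const, smul_eq_mul,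
    intervalIntegral.integral_eq_sub_of_hasDerivAt (f := s) (fun t ht => by
      rw [uIcc_of_le h12] at ht
      exact hsol.s_diff t ⟨(hmem t ht).1, (hmem t ht).2.le⟩) hsi] at hfin
  simp only [mul_zero, zero_mul, add_zero] at hfin
  linarith

lemma front_le (hsol : IsStefanSolution b T u₀ h s u) {M m U : ℝ} (hb : 0 < b) (hT : 0 < T)
    (hM : 0 ≤ M) (hhpos : ∀ t ∈ Icc (0:ℝ) T, 0 < h t) (hhm : ∀ t ∈ Icc (0:ℝ) T, h t ≤ m)
    (hu₀c : ContinuousOn u₀ (Icc 0 b)) (hU : ∀ x ∈ Icc 0 b, u₀ x ≤ U) (hU0 : 0 ≤ U)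
    (hnn : ∀ t ∈ Ico 0 T, ∀ x ∈ Icc 0 (s t), 0 ≤ u x t)
    (hle : ∀ t ∈ Ico 0 T, ∀ x ∈ Icc 0 (s t), u x t ≤ M * (s t - x))
    (hs0 : ∀ t ∈ Ioo 0 T, 0 ≤ deriv s t) (hsM : ∀ t ∈ Ioo 0 T, deriv s t ≤ M)
    (hsb : ∀ t ∈ Icc 0 T, b ≤ s t) {t : ℝ} (ht : t ∈ Ioo 0 T) :
    s t ≤ T * m + b * (U + 1) := by
  have hm : 0 < m := (hhpos 0 ⟨le_rfl, hT.le⟩).trans_le (hhm 0 ⟨le_rfl, hT.le⟩)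
  have hsT := hsol.monotoneOn_s hs0
  have hu : ∀ t ∈ Ico 0 T, ∀ x ∈ Icc 0 (s t), |u x t| ≤ M * s T + 1 := by
    intro t ht x hx
    rw [abs_of_nonneg (hnn t ht x hx)]
    have := (hle t ht x hx).trans (mul_le_mul_of_nonneg_left (b := s t - x) (c := s T)
      (by linarith [hx.1, hsT ⟨ht.1, ht.2.le⟩ ⟨hT.le, le_rfl⟩ ht.2.le]) hM)
    linarith
  have hA : 0 < M * s T + 1 := by
    have := mul_nonneg hM (hsol.s_pos T ⟨hT.le, le_rfl⟩).le
    linarith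
  have hs0' : Tendsto s (𝓝[>] 0) (𝓝 b) := by
    have := (hsol.continuousOn_s 0 ⟨le_rfl, hT.le⟩).tendsto
    rw [hsol.s_init] at this
    refine this.mono_left ?_
    rw [nhdsWithin_le_iff]
    filter_upwards [Ioo_mem_nhdsGT hT] with τ hτ using ⟨hτ.1.le, hτ.2.le⟩
  have hg : ContinuousOn (fun z : ℝ × ℝ => u (z.1 * s z.2) z.2) (Icc 0 1 ×ˢ Icc 0 T) := by
    refine (hsol.continuousOn_u hT).comp (f := fun z : ℝ × ℝ => (z.1 * s z.2, z.2)) ?_ ?_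
    · exact ContinuousOn.prodMk (continuousOn_fst.mul
        (hsol.continuousOn_s.comp continuousOn_snd fun z hz => hz.2)) continuousOn_snd
    · rintro ⟨ξ, τ⟩ ⟨hξ, hτ⟩
      have h := hsol.s_pos τ hτ
      exact ⟨hτ, mul_nonneg hξ.1 h.le, mul_le_of_le_one_left h.le hξ.2⟩
  have hgu := (isCompact_Icc.prod isCompact_Icc).uniformContinuousOn_of_continuous hg
  have key : ∀ η > 0, s t - b ≤ m * (t - 0) + (U + η) * b := by
    intro η hη
    obtain ⟨d, hd, hgd⟩ := Metric.uniformContinuousOn_iff.1 hgu η hη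
    have hev : ∀ᶠ t₁ in 𝓝[>] 0, s t - s t₁ ≤ m * (t - t₁) + (U + η) * s t₁ := by
      filter_upwards [Ioo_mem_nhdsGT hd, Ioo_mem_nhdsGT ht.1] with t₁ h1 h2
      have ht₁ : t₁ ∈ Icc 0 T := ⟨h1.1.le, by linarith [h2.2, ht.2]⟩
      obtain ⟨C, hC⟩ := hsol.exists_left_lipschitz hT hb hhpos hhm hA hu hsb h1.1
      refine hsol.front_sub_le hb hM hm.le hhm hhpos hnn hle hs0 hsM hsb h1.1 h2.2.le ht.2 hC
        (by linarith) fun x hx => ?_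
      have hst := hsol.s_pos t₁ ht₁
      have hξ : x / s t₁ ∈ Icc (0:ℝ) 1 := ⟨div_nonneg hx.1 hst.le, (div_le_one hst).2 hx.2⟩
      have h3 := hgd (x / s t₁, t₁) ⟨hξ, ht₁⟩ (x / s t₁, 0) ⟨hξ, le_rfl, hT.le⟩ (by
        rw [Prod.dist_eq, dist_self, Real.dist_eq, sub_zero, abs_of_pos h1.1]
        exact max_lt hd h1.2)
      simp only [div_mul_cancel₀ x hst.ne', hsol.s_init] at h3
      have hxb : x / s t₁ * b ∈ Icc 0 b :=
        ⟨mul_nonneg hξ.1 hb.le, mul_le_of_le_one_left hb.le hξ.2⟩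
      rw [hsol.u_initial hT hb hu₀c _ hxb, Real.dist_eq] at h3
      linarith [(abs_lt.1 h3).2, hU _ hxb]
    refine le_of_tendsto_of_tendsto (tendsto_const_nhds.sub hs0') ?_ hev
    refine Tendsto.add (Tendsto.mul tendsto_const_nhds (tendsto_const_nhds.sub ?_))
      (tendsto_const_nhds.mul hs0')
    exact tendsto_id.mono_left nhdsWithin_le_nhds
  have hlim : Tendsto (fun η : ℝ => m * (t - 0) + (U + η) * b) (𝓝[>] 0)
      (𝓝 (m * (t - 0) + (U + 0) * b)) :=
    (Continuous.tendsto (by fun_prop) 0).mono_left nhdsWithin_le_nhds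
  have := ge_of_tendsto hlim (eventually_mem_nhdsWithin.mono key)
  nlinarith [ht.2]

end IsStefanSolution

/-- bounds on the free boundary and on its `W^{1,∞}` norm. -/
theorem stefan_front_bounds (b T H : ℝ) (hb : 0 < b) (hT : 0 < T) (hH : 0 < H)
    (h u₀ : ℝ → ℝ)
    (hhc : ContinuousOn h (Icc 0 T)) (hhpos : ∀ t ∈ Icc (0:ℝ) T, 0 < h t)
    (hu₀c : ContinuousOn u₀ (Icc 0 b))
    (hu₀ : ∀ x ∈ Icc (0:ℝ) b, 0 ≤ u₀ x ∧ u₀ x ≤ H * (b - x))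
    (M : ℝ) (hM : M = max (sSup (h '' Icc 0 T)) H)
    (s : ℝ → ℝ) (u : ℝ → ℝ → ℝ)
    (hsol : IsStefanSolution b T u₀ h s u) :
    (∀ t ∈ Ioc (0:ℝ) T,
      b ≤ s t ∧ s t ≤ T * sSup (h '' Icc 0 T) + b * (sSup (u₀ '' Icc 0 b) + 1)) ∧
    W1inf T s ≤ max (T * sSup (h '' Icc 0 T) + b * (sSup (u₀ '' Icc 0 b) + 1)) M := by
  have hhm : ∀ t ∈ Icc (0:ℝ) T, h t ≤ sSup (h '' Icc 0 T) := fun t ht =>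
    le_csSup (isCompact_Icc.image_of_continuousOn hhc).bddAbove (mem_image_of_mem h ht)
  have hU : ∀ x ∈ Icc (0:ℝ) b, u₀ x ≤ sSup (u₀ '' Icc 0 b) := fun x hx =>
    le_csSup (isCompact_Icc.image_of_continuousOn hu₀c).bddAbove (mem_image_of_mem u₀ hx)
  have h0b : (0:ℝ) ∈ Icc 0 b := ⟨le_rfl, hb.le⟩
  have hU0 : 0 ≤ sSup (u₀ '' Icc 0 b) := (hu₀ 0 h0b).1.trans (hU 0 h0b)
  have hHM : H ≤ M := hM ▸ le_max_right _ _
  have hmM : sSup (h '' Icc 0 T) ≤ M := hM ▸ le_max_left _ _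
  have hM0 : 0 ≤ M := hH.le.trans hHM
  have hnn : ∀ t ∈ Ico 0 T, ∀ x ∈ Icc 0 (s t), 0 ≤ u x t := fun t ht x hx =>
    hsol.nonneg hT hb hhpos hu₀c (fun x hx => (hu₀ x hx).1) ht hx
  have hs0 : ∀ t ∈ Ioo 0 T, 0 ≤ deriv s t := fun t ht => hsol.deriv_s_nonneg hnn ht
  have hle : ∀ t ∈ Ico 0 T, ∀ x ∈ Icc 0 (s t), u x t ≤ M * (s t - x) := fun t ht x hx =>
    hsol.le_linear hT hb hhpos hu₀c hM0 (fun t ht => (hhm t ht).trans hmM)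
      (fun x hx => (hu₀ x hx).2.trans
        (mul_le_mul_of_nonneg_right hHM (by linarith [hx.2]))) hs0 ht hx
  have hsM : ∀ t ∈ Ioo 0 T, deriv s t ≤ M := fun t ht => hsol.deriv_s_le hM0 hle ht
  have hmono := hsol.monotoneOn_s hs0
  have hsb : ∀ t ∈ Icc 0 T, b ≤ s t := fun t ht => by
    have := hmono ⟨le_rfl, hT.le⟩ ht ht.1
    rwa [hsol.s_init] at this
  have hTT : T ∈ Icc 0 T := ⟨hT.le, le_rfl⟩
  have hsTle : s T ≤ T * sSup (h '' Icc 0 T) + b * (sSup (u₀ '' Icc 0 b) + 1) := by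
    have hlim : Tendsto s (𝓝[<] T) (𝓝 (s T)) :=
      (hsol.s_diff T ⟨hT, le_rfl⟩).continuousAt.tendsto.mono_left nhdsWithin_le_nhds
    refine le_of_tendsto hlim ?_
    filter_upwards [Ioo_mem_nhdsLT hT] with t ht
    exact hsol.front_le hb hT hM0 hhpos hhm hu₀c hU hU0 hnn hle hs0 hsM hsb ht
  have hsle : ∀ t ∈ Icc 0 T, s t ≤ T * sSup (h '' Icc 0 T) + b * (sSup (u₀ '' Icc 0 b) + 1) :=
    fun t ht => (hmono ht hTT ht.2).trans hsTle
  refine ⟨fun t ht => ⟨hsb t ⟨ht.1.le, ht.2⟩, hsle t ⟨ht.1.le, ht.2⟩⟩, max_le_max ?_ ?_⟩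
  · refine csSup_le ((nonempty_Icc.2 hT.le).image _) ?_
    rintro _ ⟨t, ht, rfl⟩
    simp only [abs_of_pos (hsol.s_pos t ht)]
    exact hsle t ht
  · have hne : (volume.restrict (Icc (0:ℝ) T)) ≠ 0 := by
      rw [Ne, Measure.restrict_eq_zero, Real.volume_Icc]
      simp [hT]
    have : NeBot (ae (volume.restrict (Icc (0:ℝ) T))) := ae_neBot.2 hne
    refine limsup_le_of_le (isCoboundedUnder_le_of_le _ (x := 0) fun t => abs_nonneg _) ?_
    rw [Measure.restrict_congr_set Ioo_ae_eq_Icc.symm]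
    refine (ae_restrict_iff' measurableSet_Ioo).2 (Eventually.of_forall fun t ht => ?_)
    rw [abs_of_nonneg (hs0 t ht)]
    exact hsM t ht
end
end

section
/- Let b > 0, T > 0, let s ∈ C¹([0,T]) with s(t) > 0 on [0,T] and s(0) = b, and let u₀ ∈ C¹([0,b]). If u and v both belong to C²(Q_{s,T}) ∩ C¹(closure(Q_{s,T})) and both satisfy: u_t = u_{xx} in Q_{s,T}; u(x,0) = u₀(x) for 0 < x < b; −u_x(s(t),t) = ṡ(t) for 0 < t < T; and u(s(t),t) = 0 for 0 < t < T, then u = v on the closure of Q_{s,T}. -/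
open Set MeasureTheory Real

noncomputable section

section Uniqueness

open Filter Topology

/-- A continuous function on `[0, a]` whose truncated Laplace transform decays along the integers
faster than `exp (-n * r)` for every `r < a` vanishes on `(0, a)`. -/
theorem eq_zero_of_laplace_decay {f : ℝ → ℝ} {a : ℝ} (hf : ContinuousOn f (Icc 0 a))
    (h : ∀ r < a, ∃ A, ∀ n : ℕ, 1 ≤ n →
      |∫ t in (0 : ℝ)..a, Real.exp (-(n * t)) * f t| ≤ A * Real.exp (-(n * r))) :
    ∀ t ∈ Ioo 0 a, f t = 0 := by
  intro t₀ ht₀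
  have ha : 0 < a := ht₀.1.trans ht₀.2
  have hfi : ∀ c ∈ Icc 0 a, ∀ d ∈ Icc 0 a, IntervalIntegrable f volume c d := fun c hc d hd =>
    (hf.mono ((convex_Icc 0 a).ordConnected.uIcc_subset hc hd)).intervalIntegrable
  have h0 : (0 : ℝ) ∈ Icc 0 a := ⟨le_rfl, ha.le⟩
  have h1 : a ∈ Icc 0 a := ⟨ha.le, le_rfl⟩
  have hmeas : AEStronglyMeasurable f (volume.restrict (uIoc 0 a)) := by
    simpa using (hfi 0 h0 a h1).def'.aestronglyMeasurable
  obtain ⟨B, hB⟩ := isCompact_Icc.exists_bound_of_continuousOn hf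
  have hsub : ∀ t ∈ uIoc 0 a, t ∈ Icc 0 a := fun t ht => by
    rw [uIoc_of_le ha.le] at ht; exact ⟨ht.1.le, ht.2⟩
  have key : ∀ r ∈ Ioo 0 a, ∫ t in (0 : ℝ)..r, f t = 0 := by
    intro r hr
    obtain ⟨r', hr', hr'a⟩ := exists_between hr.2
    obtain ⟨A, hA⟩ := h r' hr'a
    have hA0 : 0 ≤ A := by
      have := (abs_nonneg _).trans (hA 1 le_rfl)
      exact nonneg_of_mul_nonneg_left this (Real.exp_pos _)
    have hser : ∀ n : ℕ, HasSum (fun k : ℕ => ∫ t in (0 : ℝ)..a,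
        (-Real.exp (n * (r - t))) ^ k / k.factorial * f t)
        (∫ t in (0 : ℝ)..a, Real.exp (-Real.exp (n * (r - t))) * f t) := by
      intro n
      refine intervalIntegral.hasSum_integral_of_dominated_convergence
        (fun k _ => Real.exp (n * r) ^ k / k.factorial * B) ?_ ?_ ?_ ?_ ?_
      · intro k
        exact (Continuous.aestronglyMeasurable (by fun_prop)).mul hmeas
      · intro k
        refine ae_of_all _ fun t ht => ?_
        have ht' := hsub t ht
        rw [norm_mul, norm_div, norm_pow, norm_neg, Real.norm_eq_abs, Real.abs_exp,
          Real.norm_natCast]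
        gcongr
        · nlinarith [ht'.1, (Nat.cast_nonneg n : (0 : ℝ) ≤ n)]
        · exact hB t ht'
      · exact ae_of_all _ fun t _ => (Real.summable_pow_div_factorial _).mul_right B
      · exact intervalIntegrable_const
      · refine ae_of_all _ fun t _ => HasSum.mul_right _ ?_
        rw [Real.exp_eq_exp_ℝ]
        exact NormedSpace.expSeries_div_hasSum_exp _
    have hbound : ∀ n : ℕ, 1 ≤ n →
        ‖(∫ t in (0 : ℝ)..a, Real.exp (-Real.exp (n * (r - t))) * f t) - ∫ t in (0 : ℝ)..a, f t‖
          ≤ A * Real.exp (n * (r - r')) * Real.exp 1 := by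
      intro n hn
      have hs := (hasSum_nat_add_iff' 1).mpr (hser n)
      simp only [Finset.range_one, Finset.sum_singleton, pow_zero, Nat.factorial_zero,
        Nat.cast_one, div_one, one_mul] at hs
      have he : HasSum (fun k : ℕ => A * Real.exp (n * (r - r')) * ((1 : ℝ) ^ k / k.factorial))
          (A * Real.exp (n * (r - r')) * Real.exp 1) := by
        refine HasSum.mul_left _ ?_
        rw [Real.exp_eq_exp_ℝ]
        exact NormedSpace.expSeries_div_hasSum_exp _
      refine hs.norm_le_of_bounded he fun k => ?_
      have e1 : ∀ t, (-Real.exp (n * (r - t))) ^ (k + 1) / (k + 1).factorial * f t =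
          ((-1) ^ (k + 1) * Real.exp (((k + 1) * n : ℕ) * r) / (k + 1).factorial) *
            (Real.exp (-(((k + 1) * n : ℕ) * t)) * f t) := by
        intro t
        rw [neg_pow, ← Real.exp_nat_mul]
        have : Real.exp (((k + 1 : ℕ) : ℝ) * (n * (r - t))) =
            Real.exp (((k + 1) * n : ℕ) * r) * Real.exp (-(((k + 1) * n : ℕ) * t)) := by
          rw [← Real.exp_add]; congr 1; push_cast; ring
        rw [this]; ring
      simp only [e1]
      rw [intervalIntegral.integral_const_mul, norm_mul, norm_div, norm_mul, norm_pow, norm_neg,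
        norm_one, one_pow, one_mul, Real.norm_eq_abs, Real.abs_exp, Real.norm_natCast,
        Real.norm_eq_abs]
      have hI := hA ((k + 1) * n) (Nat.mul_pos k.succ_pos hn)
      have e2 : Real.exp (((k + 1) * n : ℕ) * r) * Real.exp (-(((k + 1) * n : ℕ) * r')) ≤
          Real.exp (n * (r - r')) := by
        rw [← Real.exp_add, Real.exp_le_exp]
        push_cast
        have : (0 : ℝ) ≤ k * n * (r' - r) := by
          have := sub_nonneg.2 hr'.le
          positivity
        linarith
      calc _ ≤ Real.exp (((k + 1) * n : ℕ) * r) / (k + 1).factorial *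
            (A * Real.exp (-(((k + 1) * n : ℕ) * r'))) := by gcongr
        _ = A * (Real.exp (((k + 1) * n : ℕ) * r) * Real.exp (-(((k + 1) * n : ℕ) * r'))) *
            (1 / (k + 1).factorial) := by ring
        _ ≤ A * Real.exp (n * (r - r')) * (1 / k.factorial) := by
            gcongr
            exact Nat.le_succ k
        _ = _ := by rw [one_pow]
    have hlim1 : Tendsto (fun n : ℕ => ∫ t in (0 : ℝ)..a, Real.exp (-Real.exp (n * (r - t))) * f t)
        atTop (𝓝 (∫ t in (0 : ℝ)..a, f t)) := by
      have hz : Tendsto (fun n : ℕ => A * Real.exp (n * (r - r')) * Real.exp 1) atTop (𝓝 0) := by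
        have : Tendsto (fun n : ℕ => Real.exp (n * (r - r'))) atTop (𝓝 0) :=
          Real.tendsto_exp_atBot.comp
            (tendsto_natCast_atTop_atTop.atTop_mul_const_of_neg (sub_neg.2 hr'))
        simpa using (this.const_mul A).mul_const (Real.exp 1)
      rw [tendsto_iff_norm_sub_tendsto_zero]
      refine squeeze_zero' (Eventually.of_forall fun _ => norm_nonneg _) ?_ hz
      filter_upwards [eventually_ge_atTop 1] with n hn using hbound n hn
    have hlim2 : Tendsto (fun n : ℕ => ∫ t in (0 : ℝ)..a, Real.exp (-Real.exp (n * (r - t))) * f t)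
        atTop (𝓝 (∫ t in (0 : ℝ)..a, (Ioi r).indicator f t)) := by
      refine intervalIntegral.tendsto_integral_filter_of_dominated_convergence (fun _ => B) ?_ ?_
        intervalIntegrable_const ?_
      · exact Eventually.of_forall fun n =>
          (Continuous.aestronglyMeasurable (by fun_prop)).mul hmeas
      · refine Eventually.of_forall fun n => ae_of_all _ fun t ht => ?_
        rw [norm_mul, Real.norm_eq_abs, Real.abs_exp]
        have : Real.exp (-Real.exp (n * (r - t))) ≤ 1 :=
          Real.exp_le_one_iff.2 (neg_nonpos.2 (Real.exp_pos _).le)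
        exact (mul_le_of_le_one_left (norm_nonneg _) this).trans (hB t (hsub t ht))
      · filter_upwards [compl_mem_ae_iff.2 (measure_singleton r)] with t htr _
        rcases lt_or_gt_of_ne (show t ≠ r from htr) with hlt | hgt
        · rw [indicator_of_notMem (by simpa using hlt.le)]
          have : Tendsto (fun n : ℕ => Real.exp (-Real.exp (n * (r - t)))) atTop (𝓝 0) :=
            Real.tendsto_exp_atBot.comp (tendsto_neg_atTop_atBot.comp
              (Real.tendsto_exp_atTop.comp
                (tendsto_natCast_atTop_atTop.atTop_mul_const (sub_pos.2 hlt))))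
          simpa using this.mul_const (f t)
        · rw [indicator_of_mem (by simpa using hgt)]
          have h2 : Tendsto (fun n : ℕ => -Real.exp (n * (r - t))) atTop (𝓝 (-0)) :=
            (Real.tendsto_exp_atBot.comp
              (tendsto_natCast_atTop_atTop.atTop_mul_const_of_neg (sub_neg.2 hgt))).neg
          have := ((Real.continuous_exp.tendsto _).comp h2).mul_const (f t)
          simpa using this
    have heq := tendsto_nhds_unique hlim1 hlim2
    have hsplit : ∫ t in (0 : ℝ)..a, (Ioi r).indicator f t = ∫ t in r..a, f t := by
      rw [intervalIntegral.integral_of_le ha.le, intervalIntegral.integral_of_le hr.2.le,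
        setIntegral_indicator measurableSet_Ioi]
      congr 2
      ext t
      simp only [mem_inter_iff, mem_Ioc, mem_Ioi]
      constructor
      · rintro ⟨⟨_, h⟩, h'⟩; exact ⟨h', h⟩
      · rintro ⟨h', h⟩; exact ⟨⟨hr.1.trans h', h⟩, h'⟩
    have hr' : r ∈ Icc 0 a := ⟨hr.1.le, hr.2.le⟩
    have := intervalIntegral.integral_add_adjacent_intervals (hfi 0 h0 r hr') (hfi r hr' a h1)
    linarith
  have hnhds : Ioo 0 a ∈ 𝓝 t₀ := Ioo_mem_nhds ht₀.1 ht₀.2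
  have hd : HasDerivAt (fun r => ∫ t in (0 : ℝ)..r, f t) (f t₀) t₀ :=
    intervalIntegral.integral_hasDerivAt_right (hfi 0 h0 t₀ ⟨ht₀.1.le, ht₀.2.le⟩)
      ((hf.mono Ioo_subset_Icc_self).stronglyMeasurableAtFilter isOpen_Ioo t₀ ht₀)
      ((hf.mono Ioo_subset_Icc_self).continuousAt hnhds)
  refine hd.unique ((hasDerivAt_const t₀ (0 : ℝ)).congr_of_eventuallyEq ?_)
  filter_upwards [hnhds] with r hr using key r hr

/-- `F` is continuous on the closed domain, differentiable in time in the interior with a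
derivative continuous up to the boundary, and vanishes on the free boundary. -/
structure VanishesOnFront (T : ℝ) (s : ℝ → ℝ) (F Ft : ℝ → ℝ → ℝ) : Prop where
  cont : ContinuousOn (fun p : ℝ × ℝ => F p.1 p.2) (closure (stefanQ T s))
  cont_t : ContinuousOn (fun p : ℝ × ℝ => Ft p.1 p.2) (closure (stefanQ T s))
  hasDerivAt_t : ∀ x t, (x, t) ∈ stefanQ T s → HasDerivAt (F x) (Ft x t) t
  front : ∀ t ∈ Ico (0 : ℝ) T, F (s t) t = 0

section Domain

variable {T : ℝ} {s : ℝ → ℝ}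

theorem mem_closure_stefanQ_of_pos {x t : ℝ} (ht : t ∈ Ioo 0 T) (hx : x ∈ Icc 0 (s t))
    (hs : 0 < s t) : (x, t) ∈ closure (stefanQ T s) := by
  rw [← closure_Ioo hs.ne] at hx
  exact map_mem_closure (f := fun y => (y, t)) (by fun_prop) hx
    fun y hy => ⟨hy.1, hy.2, ht.1, ht.2⟩

theorem tendsto_nhdsGT_zero (hT : 0 < T) (hs : ContinuousOn s (Icc 0 T)) :
    Tendsto s (𝓝[>] 0) (𝓝 (s 0)) := by
  have := (hs 0 ⟨le_rfl, hT.le⟩).mono_left (nhdsWithin_mono _ (Ioo_subset_Icc_self (a := 0)))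
  rwa [nhdsWithin_Ioo_eq_nhdsGT hT] at this

theorem mem_closure_stefanQ (hs : ContinuousOn s (Icc 0 T)) (hpos : ∀ t ∈ Icc 0 T, 0 < s t)
    {x t : ℝ} (ht : t ∈ Ico 0 T) (hx : x ∈ Icc 0 (s t)) : (x, t) ∈ closure (stefanQ T s) := by
  rcases ht.1.eq_or_lt with rfl | h0
  · have h : Tendsto (fun τ => (min x (s τ), τ)) (𝓝[>] 0) (𝓝 (min x (s 0), 0)) :=
      (tendsto_const_nhds.min (tendsto_nhdsGT_zero ht.2 hs)).prodMk_nhds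
        (tendsto_nhdsWithin_of_tendsto_nhds tendsto_id)
    rw [min_eq_left hx.2] at h
    refine isClosed_closure.mem_of_tendsto h ?_
    filter_upwards [Ioo_mem_nhdsGT ht.2] with τ hτ
    have := hpos τ ⟨hτ.1.le, hτ.2.le⟩
    exact mem_closure_stefanQ_of_pos hτ ⟨le_min hx.1 this.le, min_le_right _ _⟩ this
  · exact mem_closure_stefanQ_of_pos ⟨h0, ht.2⟩ hx (hpos t ⟨ht.1, ht.2.le⟩)

theorem isCompact_closure_stefanQ (hs : ContinuousOn s (Icc 0 T)) :
    IsCompact (closure (stefanQ T s)) := by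
  obtain ⟨M, hM⟩ := isCompact_Icc.exists_bound_of_continuousOn hs
  refine (isCompact_Icc.prod isCompact_Icc : IsCompact (Icc (0 : ℝ) M ×ˢ Icc 0 T)).of_isClosed_subset
    isClosed_closure (closure_minimal ?_ (isClosed_Icc.prod isClosed_Icc))
  rintro ⟨x, t⟩ ⟨h1, h2, h3, h4⟩
  exact ⟨⟨h1.le, h2.le.trans ((le_abs_self _).trans (hM t ⟨h3.le, h4.le⟩))⟩, h3.le, h4.le⟩

theorem exists_bound_on_stefanQ (hs : ContinuousOn s (Icc 0 T)) {F : ℝ → ℝ → ℝ}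
    (hF : ContinuousOn (fun p : ℝ × ℝ => F p.1 p.2) (closure (stefanQ T s))) :
    ∃ C, 0 ≤ C ∧ ∀ x t, (x, t) ∈ closure (stefanQ T s) → |F x t| ≤ C := by
  obtain ⟨C, hC⟩ := (isCompact_closure_stefanQ hs).exists_bound_of_continuousOn hF
  exact ⟨max C 0, le_max_right _ _, fun x t h => (hC (x, t) h).trans (le_max_left _ _)⟩

theorem continuousOn_slice (hs : ContinuousOn s (Icc 0 T)) (hpos : ∀ t ∈ Icc 0 T, 0 < s t)
    {F : ℝ → ℝ → ℝ} (hF : ContinuousOn (fun p : ℝ × ℝ => F p.1 p.2) (closure (stefanQ T s)))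
    {t : ℝ} (ht : t ∈ Ico 0 T) : ContinuousOn (fun x => F x t) (Icc 0 (s t)) :=
  hF.comp (f := fun x => (x, t)) (by fun_prop) fun _ hx => mem_closure_stefanQ hs hpos ht hx

theorem VanishesOnFront.abs_sub_le_of_lt {F Ft : ℝ → ℝ → ℝ} (hF : VanishesOnFront T s F Ft)
    (hs : ContinuousOn s (Icc 0 T)) (hpos : ∀ t ∈ Icc 0 T, 0 < s t) {C : ℝ}
    (hC : ∀ x t, (x, t) ∈ closure (stefanQ T s) → |Ft x t| ≤ C) {x a c : ℝ} (hx : 0 < x)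
    (ha : 0 ≤ a) (hac : a ≤ c) (hc : c < T) (hxa : x ≤ s a) (hxc : x ≤ s c)
    (h : ∀ t ∈ Ioo a c, x < s t) : |F x c - F x a| ≤ C * (c - a) := by
  rcases hac.eq_or_lt with rfl | hlt
  · simp
  have hle : ∀ t ∈ Icc a c, x ≤ s t := fun t ht => by
    rcases ht.1.eq_or_lt with rfl | h1
    · exact hxa
    rcases ht.2.eq_or_lt with rfl | h2
    · exact hxc
    exact (h t ⟨h1, h2⟩).le
  have hQ : ∀ t ∈ Ioo a c, (x, t) ∈ stefanQ T s := fun t ht =>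
    ⟨hx, h t ht, ha.trans_lt ht.1, ht.2.trans hc⟩
  obtain ⟨d, hd, hd'⟩ := exists_hasDerivAt_eq_slope (F x) (Ft x) hlt
    (hF.cont.comp (f := fun t => (x, t)) (by fun_prop) fun t ht =>
      mem_closure_stefanQ hs hpos ⟨ha.trans ht.1, ht.2.trans_lt hc⟩ ⟨hx.le, hle t ht⟩)
    fun t ht => hF.hasDerivAt_t x t (hQ t ht)
  have hpos' := sub_pos.2 hlt
  rw [eq_div_iff hpos'.ne'] at hd'
  rw [← hd', abs_mul, abs_of_pos hpos']
  exact mul_le_mul_of_nonneg_right (hC x d (subset_closure (hQ d hd))) hpos'.le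

/-- The extension by zero across the front is Lipschitz in time. -/
theorem VanishesOnFront.abs_extension_sub_le {F Ft : ℝ → ℝ → ℝ} (hF : VanishesOnFront T s F Ft)
    (hs : ContinuousOn s (Icc 0 T)) (hpos : ∀ t ∈ Icc 0 T, 0 < s t) {C : ℝ} (hC0 : 0 ≤ C)
    (hC : ∀ x t, (x, t) ∈ closure (stefanQ T s) → |Ft x t| ≤ C) {x t₁ t₂ : ℝ} (hx : 0 < x)
    (h₁ : 0 ≤ t₁) (h₁₂ : t₁ ≤ t₂) (h₂ : t₂ < T) :
    |(if x < s t₂ then F x t₂ else 0) - (if x < s t₁ then F x t₁ else 0)| ≤ C * (t₂ - t₁) := by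
  have hcompact : ∀ a c, 0 ≤ a → c < T → IsCompact (Icc a c ∩ s ⁻¹' {x}) := fun a c ha hc =>
    isCompact_Icc.of_isClosed_subset
      ((hs.mono (Icc_subset_Icc ha hc.le)).preimage_isClosed_of_isClosed isClosed_Icc
        isClosed_singleton) inter_subset_left
  have left : ∀ a c, 0 ≤ a → a ≤ c → c < T → s c ≤ x →
      |if x < s a then F x a else 0| ≤ C * (c - a) := by
    intro a c ha hac hc hsc
    split_ifs with hxa
    swap
    · simpa using mul_nonneg hC0 (sub_nonneg.2 hac)
    have hs' := hs.mono (Icc_subset_Icc ha hc.le)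
    obtain ⟨d, hd, hdx⟩ := intermediate_value_Icc' hac hs' ⟨hsc, hxa.le⟩
    obtain ⟨e, ⟨⟨he1, he2⟩, hex⟩, hmin⟩ := (hcompact a c ha hc).exists_isLeast ⟨d, hd, hdx⟩
    have hex : s e = x := hex
    have hlt : ∀ t ∈ Ioo a e, x < s t := by
      intro t ht
      by_contra! hcon
      obtain ⟨y, hy, hyx⟩ := intermediate_value_Icc' ht.1.le
        (hs'.mono (Icc_subset_Icc le_rfl (ht.2.le.trans he2))) ⟨hcon, hxa.le⟩
      exact absurd (hmin ⟨⟨hy.1, hy.2.trans (ht.2.le.trans he2)⟩, hyx⟩)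
        (not_le.2 (hy.2.trans_lt ht.2))
    have h0 := hF.front e ⟨ha.trans he1, he2.trans_lt hc⟩
    have := hF.abs_sub_le_of_lt hs hpos hC hx ha he1 (he2.trans_lt hc) hxa.le hex.ge hlt
    rw [hex] at h0
    rw [h0, zero_sub, abs_neg] at this
    exact this.trans (by gcongr)
  have right : ∀ a c, 0 ≤ a → a ≤ c → c < T → s a ≤ x →
      |if x < s c then F x c else 0| ≤ C * (c - a) := by
    intro a c ha hac hc hsa
    split_ifs with hxc
    swap
    · simpa using mul_nonneg hC0 (sub_nonneg.2 hac)
    have hs' := hs.mono (Icc_subset_Icc ha hc.le)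
    obtain ⟨d, hd, hdx⟩ := intermediate_value_Icc hac hs' ⟨hsa, hxc.le⟩
    obtain ⟨e, ⟨⟨he1, he2⟩, hex⟩, hmax⟩ := (hcompact a c ha hc).exists_isGreatest ⟨d, hd, hdx⟩
    have hex : s e = x := hex
    have hlt : ∀ t ∈ Ioo e c, x < s t := by
      intro t ht
      by_contra! hcon
      obtain ⟨y, hy, hyx⟩ := intermediate_value_Icc ht.2.le
        (hs'.mono (Icc_subset_Icc (he1.trans ht.1.le) le_rfl)) ⟨hcon, hxc.le⟩
      exact absurd (hmax ⟨⟨he1.trans (ht.1.le.trans hy.1), hy.2⟩, hyx⟩)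
        (not_le.2 (ht.1.trans_le hy.1))
    have h0 := hF.front e ⟨ha.trans he1, he2.trans_lt hc⟩
    have := hF.abs_sub_le_of_lt hs hpos hC hx (ha.trans he1) he2 hc hex.ge hxc.le hlt
    rw [hex] at h0
    rw [h0, sub_zero] at this
    exact this.trans (by gcongr)
  by_cases h : ∃ d ∈ Icc t₁ t₂, s d ≤ x
  · obtain ⟨d, hd, hdx⟩ := h
    have l := left t₁ d h₁ hd.1 (hd.2.trans_lt h₂) hdx
    have r := right d t₂ (h₁.trans hd.1) hd.2 h₂ hdx
    calc _ ≤ _ := abs_sub _ _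
      _ ≤ C * (t₂ - d) + C * (d - t₁) := add_le_add r l
      _ = _ := by ring
  · push Not at h
    rw [if_pos (h t₁ ⟨le_rfl, h₁₂⟩), if_pos (h t₂ ⟨h₁₂, le_rfl⟩)]
    exact hF.abs_sub_le_of_lt hs hpos hC hx h₁ h₁₂ h₂ (h t₁ ⟨le_rfl, h₁₂⟩).le
      (h t₂ ⟨h₁₂, le_rfl⟩).le fun t ht => h t ⟨ht.1.le, ht.2.le⟩

theorem integrableOn_slice (hs : ContinuousOn s (Icc 0 T)) (hpos : ∀ t ∈ Icc 0 T, 0 < s t)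
    {F : ℝ → ℝ → ℝ} (hF : ContinuousOn (fun p : ℝ × ℝ => F p.1 p.2) (closure (stefanQ T s)))
    {t x₀ : ℝ} (ht : t ∈ Ico 0 T) (hx₀ : 0 ≤ x₀) :
    IntegrableOn (fun x => F x t) (Ioo x₀ (s t)) :=
  (continuousOn_slice hs hpos hF ht).integrableOn_Icc.mono_set
    (Ioo_subset_Icc_self.trans (Icc_subset_Icc hx₀ le_rfl))

theorem VanishesOnFront.integrableOn {F Ft : ℝ → ℝ → ℝ} (hF : VanishesOnFront T s F Ft)
    (hs : ContinuousOn s (Icc 0 T)) (hpos : ∀ t ∈ Icc 0 T, 0 < s t) {t x₀ : ℝ} (ht : t ∈ Ico 0 T)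
    (hx₀ : 0 ≤ x₀) : IntegrableOn (fun x => F x t) (Ioo x₀ (s t)) :=
  integrableOn_slice hs hpos hF.cont ht hx₀

theorem VanishesOnFront.integrableOn_t {F Ft : ℝ → ℝ → ℝ} (hF : VanishesOnFront T s F Ft)
    (hs : ContinuousOn s (Icc 0 T)) (hpos : ∀ t ∈ Icc 0 T, 0 < s t) {t x₀ : ℝ} (ht : t ∈ Ico 0 T)
    (hx₀ : 0 ≤ x₀) : IntegrableOn (fun x => Ft x t) (Ioo x₀ (s t)) :=
  integrableOn_slice hs hpos hF.cont_t ht hx₀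

/-- Differentiation of a moving-domain integral whose integrand vanishes on the moving end. -/
theorem VanishesOnFront.hasDerivAt_integral {F Ft : ℝ → ℝ → ℝ} (hF : VanishesOnFront T s F Ft)
    (hs : ContinuousOn s (Icc 0 T)) (hpos : ∀ t ∈ Icc 0 T, 0 < s t) {x₀ t : ℝ} (hx₀ : 0 ≤ x₀)
    (ht : t ∈ Ioo 0 T) :
    HasDerivAt (fun τ => ∫ x in Ioo x₀ (s τ), F x τ) (∫ x in Ioo x₀ (s t), Ft x t) t := by
  obtain ⟨M, hM⟩ := isCompact_Icc.exists_bound_of_continuousOn hs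
  obtain ⟨C, hC0, hC⟩ := exists_bound_on_stefanQ hs hF.cont_t
  have hnhds : Ioo 0 T ∈ 𝓝 t := Ioo_mem_nhds ht.1 ht.2
  have hst : ContinuousAt s t := hs.continuousAt (Icc_mem_nhds ht.1 ht.2)
  simp only [← integral_indicator (measurableSet_Ioo (a := x₀))]
  refine (hasDerivAt_integral_of_dominated_loc_of_lip
    (bound := (Ioc x₀ M).indicator fun _ => C) hnhds ?_ ?_ ?_ ?_ ?_ ?_).2
  · filter_upwards [hnhds] with τ hτ
    exact ((hF.integrableOn hs hpos ⟨hτ.1.le, hτ.2⟩ hx₀).integrable_indicator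
      measurableSet_Ioo).aestronglyMeasurable
  · exact (hF.integrableOn hs hpos ⟨ht.1.le, ht.2⟩ hx₀).integrable_indicator
      measurableSet_Ioo
  · exact ((hF.integrableOn_t hs hpos ⟨ht.1.le, ht.2⟩ hx₀).integrable_indicator
      measurableSet_Ioo).aestronglyMeasurable
  · refine ae_of_all _ fun x => ?_
    by_cases hx : x ∈ Ioc x₀ M
    · have e : ∀ τ, (Ioo x₀ (s τ)).indicator (fun y => F y τ) x =
          if x < s τ then F x τ else 0 := fun τ => by
        simp [indicator_apply, hx.1]
      simp only [e]
      refine LipschitzOnWith.of_dist_le_mul fun a ha c hc => ?_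
      rw [indicator_of_mem hx, Real.coe_nnabs, abs_of_nonneg hC0]
      rcases le_total a c with hac | hca
      · rw [dist_comm, dist_comm a, Real.dist_eq, Real.dist_eq, abs_of_nonneg (sub_nonneg.2 hac)]
        exact hF.abs_extension_sub_le hs hpos hC0 hC (hx₀.trans_lt hx.1) ha.1.le hac hc.2
      · rw [Real.dist_eq, Real.dist_eq, abs_of_nonneg (sub_nonneg.2 hca)]
        exact hF.abs_extension_sub_le hs hpos hC0 hC (hx₀.trans_lt hx.1) hc.1.le hca ha.2
    · refine LipschitzOnWith.of_dist_le_mul fun a ha c hc => ?_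
      have e : ∀ τ ∈ Ioo 0 T, (Ioo x₀ (s τ)).indicator (fun y => F y τ) x = 0 := fun τ hτ =>
        indicator_of_notMem (fun h => hx ⟨h.1, h.2.le.trans
          ((le_abs_self _).trans (hM τ ⟨hτ.1.le, hτ.2.le⟩))⟩) _
      rw [e a ha, e c hc, dist_self]
      positivity
  · exact (integrable_indicator_iff measurableSet_Ioc).2 (integrableOn_const (by simp))
  · filter_upwards [compl_mem_ae_iff.2 (measure_singleton (s t))] with x hxt
    have hxt : x ≠ s t := hxt
    by_cases hx : x ∈ Ioo x₀ (s t)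
    · rw [indicator_of_mem hx]
      refine (hF.hasDerivAt_t x t ⟨hx₀.trans_lt hx.1, hx.2, ht.1, ht.2⟩).congr_of_eventuallyEq ?_
      filter_upwards [hst.eventually (lt_mem_nhds hx.2)] with τ hτ
      exact indicator_of_mem (show x ∈ Ioo x₀ (s τ) from ⟨hx.1, hτ⟩) _
    · rw [indicator_of_notMem hx]
      refine (hasDerivAt_const t (0 : ℝ)).congr_of_eventuallyEq ?_
      by_cases hx1 : x₀ < x
      · have hgt : s t < x := lt_of_le_of_ne (not_lt.1 fun h => hx ⟨hx1, h⟩) hxt.symm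
        filter_upwards [hst.eventually (gt_mem_nhds hgt)] with τ hτ
        exact indicator_of_notMem (fun h => lt_asymm h.2 hτ) _
      · exact Eventually.of_forall fun τ => indicator_of_notMem (fun h => hx1 h.1) _

/-- A moving-domain integral of a function with zero initial values tends to zero initially. -/
theorem VanishesOnFront.tendsto_integral {F Ft : ℝ → ℝ → ℝ} (hF : VanishesOnFront T s F Ft)
    (hT : 0 < T) (hs : ContinuousOn s (Icc 0 T)) (hpos : ∀ t ∈ Icc 0 T, 0 < s t)
    (hinit : ∀ x ∈ Ioo 0 (s 0), F x 0 = 0) {x₀ : ℝ} (hx₀ : 0 ≤ x₀) :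
    Tendsto (fun τ => ∫ x in Ioo x₀ (s τ), F x τ) (𝓝[>] 0) (𝓝 0) := by
  obtain ⟨M, hM⟩ := isCompact_Icc.exists_bound_of_continuousOn hs
  obtain ⟨C, hC0, hC⟩ := exists_bound_on_stefanQ hs hF.cont_t
  have hlim : Tendsto (fun τ => C * τ * M) (𝓝[>] 0) (𝓝 0) :=
    tendsto_nhdsWithin_of_tendsto_nhds (Continuous.tendsto' (by fun_prop) _ _ (by simp))
  refine squeeze_zero_norm' ?_ hlim
  filter_upwards [Ioo_mem_nhdsGT hT] with τ hτ
  have hsM : s τ ≤ M := (le_abs_self _).trans (hM τ ⟨hτ.1.le, hτ.2.le⟩)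
  have hb : ∀ x ∈ Ioo x₀ (s τ), ‖F x τ‖ ≤ C * τ := by
    intro x hx
    have h := hF.abs_extension_sub_le hs hpos hC0 hC (hx₀.trans_lt hx.1) le_rfl hτ.1.le hτ.2
    have h0 : (if x < s 0 then F x 0 else 0) = 0 := by
      split_ifs with h
      · exact hinit x ⟨hx₀.trans_lt hx.1, h⟩
      · rfl
    rwa [if_pos hx.2, h0, sub_zero, sub_zero] at h
  refine (norm_setIntegral_le_of_norm_le_const (by simp) hb).trans ?_
  have hM0 : 0 ≤ M := (hpos τ ⟨hτ.1.le, hτ.2.le⟩).le.trans hsM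
  have := hτ.1.le
  gcongr
  rw [Real.volume_real_Ioo]
  exact max_le (by linarith) hM0

end Domain

/-- `w` solves the heat equation on the domain, with zero Cauchy data on the front and zero
initial data; `wx` and `wt` are its first derivatives. -/
structure HasZeroCauchyData (T : ℝ) (s : ℝ → ℝ) (w wx wt : ℝ → ℝ → ℝ) : Prop
    extends VanishesOnFront T s w wt where
  cont_x : ContinuousOn (fun p : ℝ × ℝ => wx p.1 p.2) (closure (stefanQ T s))
  hasDerivAt_x : ∀ x t, (x, t) ∈ stefanQ T s → HasDerivAt (fun y => w y t) (wx x t) x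
  hasDerivAt_xx : ∀ x t, (x, t) ∈ stefanQ T s → HasDerivAt (fun y => wx y t) (wt x t) x
  front_x : ∀ t ∈ Ioo 0 T, wx (s t) t = 0
  init : ∀ x ∈ Ioo 0 (s 0), w x 0 = 0

namespace HasZeroCauchyData

variable {T : ℝ} {s : ℝ → ℝ} {w wx wt : ℝ → ℝ → ℝ}

theorem laplace_identity (hw : HasZeroCauchyData T s w wx wt) (hs : ContinuousOn s (Icc 0 T))
    (hpos : ∀ t ∈ Icc 0 T, 0 < s t) {x₀ a : ℝ} (hx₀ : 0 < x₀) (hlt : ∀ t ∈ Icc 0 T, x₀ < s t)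
    (ha : a ∈ Ioo 0 T) (μ : ℝ) :
    ∫ t in (0 : ℝ)..a, μ * (Real.exp (-(μ ^ 2 * t)) * w x₀ t) =
      ∫ x in Ioo x₀ (s a), w x a * (Real.exp (-(μ ^ 2 * a)) * Real.sinh (μ * (x - x₀))) := by
  have hexp : ∀ t, HasDerivAt (fun t => Real.exp (-(μ ^ 2 * t)))
      (Real.exp (-(μ ^ 2 * t)) * -(μ ^ 2)) t := fun t => by
    simpa using (((hasDerivAt_id t).const_mul (μ ^ 2)).neg).exp
  have hlin : ∀ x, HasDerivAt (fun x => μ * (x - x₀)) μ x := fun x => by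
    simpa using ((hasDerivAt_id x).sub_const x₀).const_mul μ
  have hsinh : ∀ x, HasDerivAt (fun x => Real.sinh (μ * (x - x₀)))
      (Real.cosh (μ * (x - x₀)) * μ) x := fun x => (hlin x).sinh
  have hcosh : ∀ x, HasDerivAt (fun x => Real.cosh (μ * (x - x₀)))
      (Real.sinh (μ * (x - x₀)) * μ) x := fun x => (hlin x).cosh
  have hF : VanishesOnFront T s
      (fun x t => w x t * (Real.exp (-(μ ^ 2 * t)) * Real.sinh (μ * (x - x₀))))
      (fun x t => wt x t * (Real.exp (-(μ ^ 2 * t)) * Real.sinh (μ * (x - x₀))) +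
        w x t * (Real.exp (-(μ ^ 2 * t)) * -(μ ^ 2) * Real.sinh (μ * (x - x₀)))) :=
  { cont := hw.cont.mul (Continuous.continuousOn (by fun_prop))
    cont_t := (hw.cont_t.mul (Continuous.continuousOn (by fun_prop))).add
      (hw.cont.mul (Continuous.continuousOn (by fun_prop)))
    hasDerivAt_t := fun x t hx => (hw.hasDerivAt_t x t hx).mul ((hexp t).mul_const _)
    front := fun t ht => by simp [hw.front t ht] }
  have hflux : ∀ t ∈ Ioo 0 T, ∫ x in Ioo x₀ (s t),
      (wt x t * (Real.exp (-(μ ^ 2 * t)) * Real.sinh (μ * (x - x₀))) +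
        w x t * (Real.exp (-(μ ^ 2 * t)) * -(μ ^ 2) * Real.sinh (μ * (x - x₀)))) =
      μ * (Real.exp (-(μ ^ 2 * t)) * w x₀ t) := by
    intro t ht
    have ht' : t ∈ Ico 0 T := ⟨ht.1.le, ht.2⟩
    have hxs := (hlt t ⟨ht.1.le, ht.2.le⟩).le
    have hsub : Icc x₀ (s t) ⊆ Icc 0 (s t) := Icc_subset_Icc hx₀.le le_rfl
    rw [← integral_Ioc_eq_integral_Ioo, ← intervalIntegral.integral_of_le hxs,
      intervalIntegral.integral_eq_sub_of_hasDerivAt_of_le hxs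
        (f := fun x => Real.exp (-(μ ^ 2 * t)) *
          (wx x t * Real.sinh (μ * (x - x₀)) - w x t * (Real.cosh (μ * (x - x₀)) * μ)))]
    · simp [hw.front t ht', hw.front_x t ht]; ring
    · have h1 := (continuousOn_slice hs hpos hw.cont ht').mono hsub
      have h2 := (continuousOn_slice hs hpos hw.cont_x ht').mono hsub
      exact continuousOn_const.mul ((h2.mul (Continuous.continuousOn (by fun_prop))).sub
        (h1.mul (Continuous.continuousOn (by fun_prop))))
    · intro x hx
      have hQ : (x, t) ∈ stefanQ T s := ⟨hx₀.trans hx.1, hx.2, ht.1, ht.2⟩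
      refine ((((hw.hasDerivAt_xx x t hQ).mul (hsinh x)).sub
        ((hw.hasDerivAt_x x t hQ).mul ((hcosh x).mul_const μ))).const_mul
          (Real.exp (-(μ ^ 2 * t)))).congr_deriv ?_
      ring
    · rw [intervalIntegrable_iff_integrableOn_Ioo_of_le hxs (by simp)]
      exact hF.integrableOn_t hs hpos ht' hx₀.le
  have hd : ∀ t ∈ Ioo 0 T, HasDerivAt
      (fun τ => ∫ x in Ioo x₀ (s τ),
        w x τ * (Real.exp (-(μ ^ 2 * τ)) * Real.sinh (μ * (x - x₀))))
      (μ * (Real.exp (-(μ ^ 2 * t)) * w x₀ t)) t := fun t ht => by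
    rw [← hflux t ht]
    exact hF.hasDerivAt_integral hs hpos hx₀.le ht
  have hT : 0 < T := ha.1.trans ha.2
  have hcont : ContinuousOn (fun t => w x₀ t) (Icc 0 a) :=
    hw.cont.comp (f := fun t => (x₀, t)) (by fun_prop) fun t ht =>
      mem_closure_stefanQ hs hpos ⟨ht.1, ht.2.trans_lt ha.2⟩
        ⟨hx₀.le, (hlt t ⟨ht.1, ht.2.trans ha.2.le⟩).le⟩
  rw [intervalIntegral.integral_eq_sub_of_hasDerivAt_of_tendsto ha.1
    (fun t ht => hd t ⟨ht.1, ht.2.trans ha.2⟩) ?_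
    (hF.tendsto_integral hT hs hpos (fun x hx => by simp [hw.init x hx]) hx₀.le)
    ((hd a ha).continuousAt.tendsto.mono_left nhdsWithin_le_nhds), sub_zero]
  refine ContinuousOn.intervalIntegrable ?_
  rw [uIcc_of_le ha.1.le]
  exact continuousOn_const.mul ((Continuous.continuousOn (by fun_prop)).mul hcont)

/-- Vanishing on every vertical line that stays inside the domain. -/
theorem eq_zero_of_forall_lt (hw : HasZeroCauchyData T s w wx wt) (hs : ContinuousOn s (Icc 0 T))
    (hpos : ∀ t ∈ Icc 0 T, 0 < s t) {x₀ t : ℝ} (hx₀ : 0 < x₀) (hlt : ∀ t ∈ Icc 0 T, x₀ < s t)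
    (ht : t ∈ Ioo 0 T) : w x₀ t = 0 := by
  obtain ⟨a, hta, haT⟩ := exists_between ht.2
  have ha : a ∈ Ioo 0 T := ⟨ht.1.trans hta, haT⟩
  have hcont : ContinuousOn (fun t => w x₀ t) (Icc 0 a) :=
    hw.cont.comp (f := fun t => (x₀, t)) (by fun_prop) fun t ht =>
      mem_closure_stefanQ hs hpos ⟨ht.1, ht.2.trans_lt ha.2⟩
        ⟨hx₀.le, (hlt t ⟨ht.1, ht.2.trans ha.2.le⟩).le⟩
  refine eq_zero_of_laplace_decay hcont (fun r hr => ?_) t ⟨ht.1, hta⟩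
  obtain ⟨C, hC0, hC⟩ := exists_bound_on_stefanQ hs hw.cont
  set L := s a - x₀
  have hL0 : 0 < L := sub_pos.2 (hlt a ⟨ha.1.le, ha.2.le⟩)
  refine ⟨C * Real.exp (L ^ 2 / (4 * (a - r))) * L, fun n hn => ?_⟩
  have hn1 : (1 : ℝ) ≤ n := by exact_mod_cast hn
  have hsq : Real.sqrt n ^ 2 = n := Real.sq_sqrt (Nat.cast_nonneg n)
  have hμ : 1 ≤ Real.sqrt n := Real.one_le_sqrt.2 hn1
  have hid := hw.laplace_identity hs hpos hx₀ hlt ha (Real.sqrt n)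
  rw [intervalIntegral.integral_const_mul, hsq] at hid
  have hest : ∀ x ∈ Ioo x₀ (s a),
      ‖w x a * (Real.exp (-(n * a)) * Real.sinh (Real.sqrt n * (x - x₀)))‖ ≤
        C * (Real.exp (L ^ 2 / (4 * (a - r))) * Real.exp (-(n * r))) := by
    intro x hx
    have hw' := hC x a (subset_closure ⟨hx₀.trans hx.1, hx.2, ha⟩)
    have hy0 : 0 ≤ Real.sqrt n * (x - x₀) := mul_nonneg (by linarith) (sub_nonneg.2 hx.1.le)
    have hy : Real.sqrt n * (x - x₀) ≤ Real.sqrt n * L := by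
      gcongr
      exact sub_le_sub_right hx.2.le x₀
    have hsinh : Real.sinh (Real.sqrt n * (x - x₀)) ≤ Real.exp (Real.sqrt n * L) := by
      rw [Real.sinh_eq]
      have h1 := Real.exp_le_exp.2 hy
      have h2 := Real.exp_pos (-(Real.sqrt n * (x - x₀)))
      have h3 := Real.exp_pos (Real.sqrt n * (x - x₀))
      linarith
    rw [norm_mul, norm_mul, Real.norm_eq_abs, Real.norm_eq_abs, Real.norm_eq_abs, Real.abs_exp,
      abs_of_nonneg (Real.sinh_nonneg_iff.2 hy0)]
    refine mul_le_mul hw' ?_ (mul_nonneg (Real.exp_pos _).le (Real.sinh_nonneg_iff.2 hy0)) hC0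
    calc _ ≤ Real.exp (-(n * a)) * Real.exp (Real.sqrt n * L) := by gcongr
      _ ≤ _ := by
        rw [← Real.exp_add, ← Real.exp_add, Real.exp_le_exp]
        have hδ : 0 < a - r := sub_pos.2 hr
        have : Real.sqrt n * L ≤ n * (a - r) + L ^ 2 / (4 * (a - r)) := by
          rw [← sub_nonneg]
          have : n * (a - r) + L ^ 2 / (4 * (a - r)) - Real.sqrt n * L =
              (2 * Real.sqrt n * (a - r) - L) ^ 2 / (4 * (a - r)) := by
            field_simp
            linear_combination (-4 * (a - r) ^ 2) * hsq
          rw [this]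
          positivity
        linarith
  have hfin := norm_setIntegral_le_of_norm_le_const (μ := volume) (by simp) hest
  rw [← hid, norm_mul, Real.norm_of_nonneg (by linarith), Real.volume_real_Ioo,
    max_eq_left hL0.le, Real.norm_eq_abs] at hfin
  calc _ ≤ _ := le_mul_of_one_le_left (abs_nonneg _) hμ
    _ ≤ _ := hfin
    _ = _ := by ring

theorem eq_zero (hw : HasZeroCauchyData T s w wx wt) (hs : ContinuousOn s (Icc 0 T))
    (hpos : ∀ t ∈ Icc 0 T, 0 < s t) {x t : ℝ} (hxt : (x, t) ∈ stefanQ T s) : w x t = 0 := by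
  have ht : t ∈ Ioo 0 T := hxt.2.2
  have hT : 0 < T := ht.1.trans ht.2
  obtain ⟨t₀, ht₀, hmin⟩ := isCompact_Icc.exists_isMinOn (nonempty_Icc.2 hT.le) hs
  obtain ⟨x₀, hx₀, hx₀x⟩ := exists_between (lt_min hxt.1 (hpos t₀ ht₀))
  obtain ⟨hx₀x, hx₀s⟩ := lt_min_iff.1 hx₀x
  have hlt : ∀ τ ∈ Icc 0 T, x₀ < s τ := fun τ hτ => hx₀s.trans_le (hmin hτ)
  have hF : VanishesOnFront T s (fun x t => w x t * w x t)
      (fun x t => wt x t * w x t + w x t * wt x t) :=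
  { cont := hw.cont.mul hw.cont
    cont_t := (hw.cont_t.mul hw.cont).add (hw.cont.mul hw.cont_t)
    hasDerivAt_t := fun x t hx => (hw.hasDerivAt_t x t hx).mul (hw.hasDerivAt_t x t hx)
    front := fun t ht => by simp [hw.front t ht] }
  set E : ℝ → ℝ := fun τ => ∫ x in Ioo x₀ (s τ), w x τ * w x τ
  have hE0 : ∀ τ, 0 ≤ E τ := fun τ => integral_nonneg fun x => mul_self_nonneg _
  have hd : ∀ τ ∈ Ioo 0 T, HasDerivAt E
      (∫ x in Ioo x₀ (s τ), (wt x τ * w x τ + w x τ * wt x τ)) τ := fun τ hτ =>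
    hF.hasDerivAt_integral hs hpos hx₀.le hτ
  have hneg : ∀ τ ∈ Ioo 0 T, ∫ x in Ioo x₀ (s τ), (wt x τ * w x τ + w x τ * wt x τ) ≤ 0 := by
    intro τ hτ
    have hτ' : τ ∈ Ico 0 T := ⟨hτ.1.le, hτ.2⟩
    have hxs := (hlt τ ⟨hτ.1.le, hτ.2.le⟩).le
    have hsub : Icc x₀ (s τ) ⊆ Icc 0 (s τ) := Icc_subset_Icc hx₀.le le_rfl
    have h1 := (continuousOn_slice hs hpos hw.cont hτ').mono hsub
    have h2 := (continuousOn_slice hs hpos hw.cont_x hτ').mono hsub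
    have hi := hF.integrableOn_t hs hpos hτ' hx₀.le
    have hi2 : IntegrableOn (fun x => wx x τ * wx x τ + wx x τ * wx x τ) (Ioo x₀ (s τ)) :=
      (((h2.mul h2).add (h2.mul h2)).integrableOn_Icc).mono_set Ioo_subset_Icc_self
    have hint : ∫ x in x₀..s τ, ((wt x τ * w x τ + w x τ * wt x τ) +
        (wx x τ * wx x τ + wx x τ * wx x τ)) =
        2 * (w (s τ) τ * wx (s τ) τ) - 2 * (w x₀ τ * wx x₀ τ) := by
      refine intervalIntegral.integral_eq_sub_of_hasDerivAt_of_le hxs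
        (f := fun x => 2 * (w x τ * wx x τ)) (continuousOn_const.mul (h1.mul h2)) ?_ ?_
      · intro y hy
        have hQ : (y, τ) ∈ stefanQ T s := ⟨hx₀.trans hy.1, hy.2, hτ⟩
        refine (((hw.hasDerivAt_x y τ hQ).mul (hw.hasDerivAt_xx y τ hQ)).const_mul 2).congr_deriv ?_
        ring
      · rw [intervalIntegrable_iff_integrableOn_Ioo_of_le hxs (by simp)]
        exact hi.add hi2
    rw [hw.front τ hτ', hw.eq_zero_of_forall_lt hs hpos hx₀ hlt hτ,
      intervalIntegral.integral_of_le hxs, integral_Ioc_eq_integral_Ioo,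
      integral_add hi hi2] at hint
    have : 0 ≤ ∫ x in Ioo x₀ (s τ), (wx x τ * wx x τ + wx x τ * wx x τ) :=
      integral_nonneg fun x => add_nonneg (mul_self_nonneg _) (mul_self_nonneg _)
    linarith
  have hanti : AntitoneOn E (Ioo 0 T) := by
    refine antitoneOn_of_deriv_nonpos (convex_Ioo 0 T)
      (fun τ hτ => (hd τ hτ).continuousAt.continuousWithinAt) ?_ ?_ <;> rw [interior_Ioo]
    · exact fun τ hτ => (hd τ hτ).differentiableAt.differentiableWithinAt
    · intro τ hτ
      rw [(hd τ hτ).deriv]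
      exact hneg τ hτ
  have hE_le : E t ≤ 0 := by
    refine ge_of_tendsto (hF.tendsto_integral hT hs hpos (fun x hx => by simp [hw.init x hx])
      hx₀.le) ?_
    filter_upwards [Ioo_mem_nhdsGT ht.1] with τ hτ
    exact hanti ⟨hτ.1, hτ.2.trans ht.2⟩ ht hτ.2.le
  have ht' : t ∈ Ico 0 T := ⟨ht.1.le, ht.2⟩
  have hEt : E t = 0 := le_antisymm hE_le (hE0 t)
  have hae := (setIntegral_eq_zero_iff_of_nonneg_ae
    (Eventually.of_forall fun x => mul_self_nonneg (w x t))
    (hF.integrableOn hs hpos ht' hx₀.le)).1 hEt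
  have hcont : ContinuousOn (fun x => w x t * w x t) (Ioo x₀ (s t)) :=
    ((continuousOn_slice hs hpos hw.cont ht').mul (continuousOn_slice hs hpos hw.cont ht')).mono
      (Ioo_subset_Icc_self.trans (Icc_subset_Icc hx₀.le le_rfl))
  have := Measure.eqOn_open_of_ae_eq hae isOpen_Ioo hcont continuousOn_const ⟨hx₀x, hxt.2.1⟩
  exact mul_self_eq_zero.1 this

end HasZeroCauchyData

theorem ContDiffAt.hasDerivAt_slices {u : ℝ → ℝ → ℝ} {x t : ℝ}
    (hu : ContDiffAt ℝ 2 (fun q : ℝ × ℝ => u q.1 q.2) (x, t)) :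
    HasDerivAt (fun y => u y t) (deriv (fun y => u y t) x) x ∧
    HasDerivAt (fun y => deriv (fun z => u z t) y) (deriv (fun y => deriv (fun z => u z t) y) x) x ∧
    HasDerivAt (u x) (deriv (fun τ => u x τ) t) t := by
  have hx : ContDiffAt ℝ 2 (fun y => u y t) x :=
    ContDiffAt.comp (f := fun y => (y, t)) x hu (by fun_prop)
  have ht : ContDiffAt ℝ 2 (fun τ => u x τ) t :=
    ContDiffAt.comp (f := fun τ => (x, τ)) t hu (by fun_prop)
  have hxx : ContDiffAt ℝ 1 (deriv fun y => u y t) x := hx.derivWithin (by norm_num)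
  exact ⟨(hx.differentiableAt (by simp)).hasDerivAt, (hxx.differentiableAt (by simp)).hasDerivAt,
    (ht.differentiableAt (by simp)).hasDerivAt⟩

end Uniqueness

/-- uniqueness for the non-standard Cauchy problem `(P)` arising from
the inverse Stefan problem. -/
theorem cauchy_problem_uniqueness (b T : ℝ) (hb : 0 < b) (hT : 0 < T)
    (s u₀ : ℝ → ℝ)
    (hs : ContDiffOn ℝ 1 s (Icc 0 T)) (hspos : ∀ t ∈ Icc (0:ℝ) T, 0 < s t)
    (hs0 : s 0 = b)
    (hu₀ : ContDiffOn ℝ 1 u₀ (Icc 0 b))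
    (u v : ℝ → ℝ → ℝ)
    -- u ∈ C²(Q_{s,T})
    (hu2 : ∀ p ∈ stefanQ T s, ContDiffAt ℝ 2 (fun q : ℝ × ℝ => u q.1 q.2) p)
    -- u ∈ C¹(closure Q_{s,T})
    (hucl : ContinuousOn (fun p : ℝ × ℝ => u p.1 p.2) (closure (stefanQ T s)))
    (hux : ContinuousOn (fun p : ℝ × ℝ => deriv (fun y => u y p.2) p.1) (closure (stefanQ T s)))
    (hut : ContinuousOn (fun p : ℝ × ℝ => deriv (fun τ => u p.1 τ) p.2) (closure (stefanQ T s)))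
    (huheat : ∀ x t, (x, t) ∈ stefanQ T s →
      deriv (fun τ => u x τ) t = deriv (fun y => deriv (fun z => u z t) y) x)
    (huinit : ∀ x ∈ Ioo (0:ℝ) b, u x 0 = u₀ x)
    (hustefan : ∀ t ∈ Ioo (0:ℝ) T, deriv (fun y => u y t) (s t) = -(deriv s t))
    (hufront : ∀ t ∈ Ioo (0:ℝ) T, u (s t) t = 0)
    -- v ∈ C²(Q_{s,T})
    (hv2 : ∀ p ∈ stefanQ T s, ContDiffAt ℝ 2 (fun q : ℝ × ℝ => v q.1 q.2) p)
    -- v ∈ C¹(closure Q_{s,T})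
    (hvcl : ContinuousOn (fun p : ℝ × ℝ => v p.1 p.2) (closure (stefanQ T s)))
    (hvx : ContinuousOn (fun p : ℝ × ℝ => deriv (fun y => v y p.2) p.1) (closure (stefanQ T s)))
    (hvt : ContinuousOn (fun p : ℝ × ℝ => deriv (fun τ => v p.1 τ) p.2) (closure (stefanQ T s)))
    (hvheat : ∀ x t, (x, t) ∈ stefanQ T s →
      deriv (fun τ => v x τ) t = deriv (fun y => deriv (fun z => v z t) y) x)
    (hvinit : ∀ x ∈ Ioo (0:ℝ) b, v x 0 = u₀ x)
    (hvstefan : ∀ t ∈ Ioo (0:ℝ) T, deriv (fun y => v y t) (s t) = -(deriv s t))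
    (hvfront : ∀ t ∈ Ioo (0:ℝ) T, v (s t) t = 0) :
    EqOn (fun p : ℝ × ℝ => u p.1 p.2) (fun p : ℝ × ℝ => v p.1 p.2)
      (closure (stefanQ T s)) := by
  have hsc := hs.continuousOn
  have hw : HasZeroCauchyData T s (fun x t => u x t - v x t)
      (fun x t => deriv (fun y => u y t) x - deriv (fun y => v y t) x)
      (fun x t => deriv (fun τ => u x τ) t - deriv (fun τ => v x τ) t) :=
    { cont := hucl.sub hvcl
      cont_t := hut.sub hvt
      cont_x := hux.sub hvx
      hasDerivAt_t := fun x t h =>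
        (hu2 _ h).hasDerivAt_slices.2.2.sub (hv2 _ h).hasDerivAt_slices.2.2
      hasDerivAt_x := fun x t h => (hu2 _ h).hasDerivAt_slices.1.sub (hv2 _ h).hasDerivAt_slices.1
      hasDerivAt_xx := fun x t h => by
        rw [huheat x t h, hvheat x t h]
        exact (hu2 _ h).hasDerivAt_slices.2.1.sub (hv2 _ h).hasDerivAt_slices.2.1
      front_x := fun t ht => by rw [hustefan t ht, hvstefan t ht, sub_self]
      init := fun x hx => by
        rw [hs0] at hx
        rw [huinit x hx, hvinit x hx, sub_self]
      front := fun t ht => by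
        rcases ht.1.eq_or_lt with rfl | h0
        · have hlim : Filter.Tendsto (fun τ => (s τ, τ)) (nhdsWithin 0 (Ioi 0))
              (nhdsWithin (s 0, 0) (closure (stefanQ T s))) := by
            refine tendsto_nhdsWithin_iff.2 ⟨(tendsto_nhdsGT_zero hT hsc).prodMk_nhds
              (tendsto_nhdsWithin_of_tendsto_nhds Filter.tendsto_id), ?_⟩
            filter_upwards [Ioo_mem_nhdsGT hT] with τ hτ
            exact mem_closure_stefanQ hsc hspos ⟨hτ.1.le, hτ.2⟩
              ⟨(hspos τ ⟨hτ.1.le, hτ.2.le⟩).le, le_rfl⟩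
          have hmem := mem_closure_stefanQ hsc hspos ⟨le_rfl, hT⟩
            ⟨(hspos 0 ⟨le_rfl, hT.le⟩).le, le_rfl⟩
          refine tendsto_nhds_unique (((hucl.sub hvcl) (s 0, 0) hmem).tendsto.comp hlim)
            (tendsto_const_nhds.congr' ?_)
          filter_upwards [Ioo_mem_nhdsGT hT] with τ hτ
          simp [hufront τ hτ, hvfront τ hτ]
        · rw [hufront t ⟨h0, ht.2⟩, hvfront t ⟨h0, ht.2⟩, sub_self] }
  exact (show EqOn _ _ (stefanQ T s) from fun p hp =>
    sub_eq_zero.1 (hw.eq_zero hsc hspos hp)).of_subset_closure hucl hvcl subset_closure subset_rfl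
end
end

section
/- For every b > 0, T > 0 and R > 0 there exists a constant C > 0 (depending only on b, T and R) with the following property: let u₀ ∈ C([0,b]) be nonnegative, and let s, s̃ be Lipschitz functions on [0,T] with s(0) = s̃(0) = b, s(t) > 0 and s̃(t) > 0 on [0,T], and ‖s‖_{W^{1,∞}} ≤ R, ‖s̃‖_{W^{1,∞}} ≤ R. Then for every t ∈ (0,T): | ∫₀ᵇ (N(s(t),ξ;t,0) − N(s̃(t),ξ;t,0)) u₀(ξ) dξ | ≤ C · (sup_{[0,b]} u₀) · ‖s − s̃‖_{W^{1,∞}}. -/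
open Set MeasureTheory Real

noncomputable section

theorem abs_mul_exp_neg_sq_div_two_le_one (r : ℝ) : |r| * exp (-(r ^ 2 / 2)) ≤ 1 := by
  rw [exp_neg, ← div_eq_mul_inv, div_le_one (exp_pos _)]
  nlinarith [add_one_le_exp (r ^ 2 / 2), sq_nonneg (|r| - 1), sq_abs r]

theorem abs_exp_neg_sq_div_two_sub_le (p q : ℝ) :
    |exp (-(p ^ 2 / 2)) - exp (-(q ^ 2 / 2))| ≤ |p - q| := by
  have hder (r : ℝ) :
      HasDerivAt (fun r : ℝ => exp (-(r ^ 2 / 2))) (-r * exp (-(r ^ 2 / 2))) r := by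
    have h : HasDerivAt (fun r : ℝ => -(r ^ 2 / 2)) (-r) r := by
      simpa using ((hasDerivAt_pow 2 r).div_const 2).fun_neg
    simpa only [mul_comm] using h.exp
  have h := convex_univ.norm_image_sub_le_of_norm_hasDerivWithin_le (C := 1)
    (fun r _ => (hder r).hasDerivWithinAt)
    (fun r _ => by
      rw [norm_mul, norm_neg, norm_eq_abs, norm_eq_abs, abs_of_pos (exp_pos _)]
      exact abs_mul_exp_neg_sq_div_two_le_one r) (mem_univ q) (mem_univ p)
  simpa using h

theorem abs_exp_neg_sq_sub_le (p q : ℝ) :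
    |exp (-p ^ 2) - exp (-q ^ 2)| ≤
      |p - q| * (exp (-(p ^ 2 / 2)) + exp (-(q ^ 2 / 2))) := by
  have hsq (r : ℝ) : exp (-r ^ 2) = exp (-(r ^ 2 / 2)) ^ 2 := by
    rw [← exp_nat_mul]
    congr 1
    push_cast
    ring
  rw [hsq, hsq, sq_sub_sq, abs_mul, mul_comm, abs_of_pos (add_pos (exp_pos _) (exp_pos _))]
  exact mul_le_mul_of_nonneg_right (abs_exp_neg_sq_div_two_sub_le p q) (by positivity)

theorem abs_Kker_sub_le {t : ℝ} (ht : 0 < t) (x y ξ : ℝ) :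
    |Kker x ξ t 0 - Kker y ξ t 0| ≤
      (2 * √(π * t))⁻¹ * (|x - y| / (2 * √t)) *
        (exp (-(8 * t)⁻¹ * (ξ - x) ^ 2) + exp (-(8 * t)⁻¹ * (ξ - y) ^ 2)) := by
  have hs : 0 < √t := sqrt_pos.2 ht
  have hst : √t ^ 2 = t := sq_sqrt ht.le
  have h := abs_exp_neg_sq_sub_le ((x - ξ) / (2 * √t)) ((y - ξ) / (2 * √t))
  have hexp (z : ℝ) : -(z - ξ) ^ 2 / (4 * t) = -((z - ξ) / (2 * √t)) ^ 2 := by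
    rw [div_pow, mul_pow, hst]
    ring
  have hhalf (z : ℝ) : -(8 * t)⁻¹ * (ξ - z) ^ 2 = -(((z - ξ) / (2 * √t)) ^ 2 / 2) := by
    rw [div_pow, mul_pow, hst]
    field_simp
    ring
  have hdist : |(x - ξ) / (2 * √t) - (y - ξ) / (2 * √t)| = |x - y| / (2 * √t) := by
    rw [← sub_div, sub_sub_sub_cancel_right, abs_div, abs_of_pos (by positivity : 0 < 2 * √t)]
  simp only [Kker, sub_zero]
  rw [hexp, hexp, hhalf, hhalf, ← mul_sub, abs_mul, abs_of_pos (by positivity), mul_assoc, ← hdist]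
  gcongr

theorem abs_Nker_sub_le {t : ℝ} (ht : 0 < t) (x y ξ : ℝ) :
    |Nker x ξ t 0 - Nker y ξ t 0| ≤
      (2 * √(π * t))⁻¹ * (|x - y| / (2 * √t)) *
        ((exp (-(8 * t)⁻¹ * (ξ - x) ^ 2) + exp (-(8 * t)⁻¹ * (ξ - y) ^ 2)) +
          (exp (-(8 * t)⁻¹ * (ξ - -x) ^ 2) + exp (-(8 * t)⁻¹ * (ξ - -y) ^ 2))) := by
  have h := abs_Kker_sub_le ht (-x) (-y) ξ
  rw [neg_sub_neg, abs_sub_comm y x] at h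
  rw [Nker, Nker, add_sub_add_comm, mul_add]
  exact (abs_add_le _ _).trans (add_le_add (abs_Kker_sub_le ht x y ξ) h)

theorem integrable_exp_neg_mul_sub_sq {c : ℝ} (hc : 0 < c) (x : ℝ) :
    Integrable fun ξ : ℝ => exp (-c * (ξ - x) ^ 2) :=
  (integrable_exp_neg_mul_sq hc).comp_sub_right x

theorem intervalIntegral_exp_neg_mul_sub_sq_le {a b c : ℝ} (hab : a ≤ b) (hc : 0 < c) (x : ℝ) :
    ∫ ξ in a..b, exp (-c * (ξ - x) ^ 2) ≤ √(π / c) := by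
  rw [intervalIntegral.integral_of_le hab, ← integral_gaussian,
    ← integral_sub_right_eq_self (fun ξ => exp (-c * ξ ^ 2)) x]
  exact setIntegral_le_integral (integrable_exp_neg_mul_sub_sq hc x)
    (Filter.Eventually.of_forall fun _ => (exp_pos _).le)

theorem abs_integral_Nker_sub_mul_le {b t M : ℝ} (hb : 0 ≤ b) (ht : 0 < t) {u : ℝ → ℝ}
    (hM : 0 ≤ M) (hu : ∀ ξ ∈ Icc 0 b, |u ξ| ≤ M) (x y : ℝ) :
    |∫ ξ in (0:ℝ)..b, (Nker x ξ t 0 - Nker y ξ t 0) * u ξ| ≤ √8 * M * (|x - y| / √t) := by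
  have hc : 0 < (8 * t)⁻¹ := by positivity
  have hint (z : ℝ) :
      IntervalIntegrable (fun ξ => exp (-(8 * t)⁻¹ * (ξ - z) ^ 2)) volume 0 b :=
    (integrable_exp_neg_mul_sub_sq hc z).intervalIntegrable
  have hle (z : ℝ) : ∫ ξ in (0:ℝ)..b, exp (-(8 * t)⁻¹ * (ξ - z) ^ 2) ≤ √8 * √(π * t) := by
    refine (intervalIntegral_exp_neg_mul_sub_sq_le hb hc z).trans_eq ?_
    rw [← sqrt_mul (by norm_num), div_inv_eq_mul]
    congr 1
    ring
  have hbound := intervalIntegral.norm_integral_le_of_norm_le (μ := volume) hb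
    (f := fun ξ => (Nker x ξ t 0 - Nker y ξ t 0) * u ξ)
    (Filter.Eventually.of_forall fun ξ hξ => by
      rw [norm_mul, norm_eq_abs, norm_eq_abs]
      exact mul_le_mul (abs_Nker_sub_le ht x y ξ) (hu ξ (Ioc_subset_Icc_self hξ))
        (abs_nonneg _) (by positivity))
    (((((hint x).add (hint y)).add ((hint (-x)).add (hint (-y)))).const_mul _).mul_const M)
  rw [norm_eq_abs, intervalIntegral.integral_mul_const, intervalIntegral.integral_const_mul,
    intervalIntegral.integral_add ((hint x).add (hint y)) ((hint (-x)).add (hint (-y))),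
    intervalIntegral.integral_add (hint x) (hint y),
    intervalIntegral.integral_add (hint (-x)) (hint (-y))] at hbound
  have hpt : 0 < √(π * t) := sqrt_pos.2 (by positivity)
  have hst : 0 < √t := sqrt_pos.2 ht
  calc _ ≤ _ := hbound
    _ ≤ (2 * √(π * t))⁻¹ * (|x - y| / (2 * √t)) *
        ((√8 * √(π * t) + √8 * √(π * t)) + (√8 * √(π * t) + √8 * √(π * t))) * M := by
      gcongr <;> exact hle _
    _ = √8 * M * (|x - y| / √t) := by
      field_simp
      ring

theorem ae_abs_deriv_le_essSup {T : ℝ} {f : ℝ → ℝ} {L : NNReal}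
    (hf : LipschitzOnWith L f (Icc 0 T)) :
    ∀ᵐ τ ∂volume.restrict (Icc (0:ℝ) T),
      |deriv f τ| ≤ essSup (fun t => |deriv f t|) (volume.restrict (Icc (0:ℝ) T)) := by
  refine ae_le_essSup ⟨L, Filter.eventually_map.2 ?_⟩
  rw [← restrict_Ioo_eq_restrict_Icc]
  filter_upwards [ae_restrict_mem measurableSet_Ioo] with τ hτ
  exact norm_deriv_le_of_lipschitzOn (Icc_mem_nhds hτ.1 hτ.2) hf

theorem abs_le_mul_W1inf {T t : ℝ} {f : ℝ → ℝ} {L : NNReal}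
    (hf : LipschitzOnWith L f (Icc 0 T)) (h0 : f 0 = 0) (ht : t ∈ Icc 0 T) :
    |f t| ≤ t * W1inf T f := by
  have hsub : Icc 0 t ⊆ Icc 0 T := Icc_subset_Icc_right ht.2
  have hac : AbsolutelyContinuousOnInterval f 0 t :=
    LipschitzOnWith.absolutelyContinuousOnInterval (by rw [uIcc_of_le ht.1]; exact hf.mono hsub)
  have hftc := hac.integral_deriv_eq_sub
  rw [h0, sub_zero] at hftc
  have hae := (ae_restrict_iff' measurableSet_Icc).1 (ae_abs_deriv_le_essSup hf)
  have h := intervalIntegral.norm_integral_le_of_norm_le_const_ae (a := 0) (b := t)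
    (f := deriv f) (C := W1inf T f) (by
      filter_upwards [hae] with τ hτ hmem
      rw [uIoc_of_le ht.1] at hmem
      exact (hτ (hsub (Ioc_subset_Icc_self hmem))).trans (le_max_right _ _))
  rwa [hftc, sub_zero, abs_of_nonneg ht.1, norm_eq_abs, mul_comm] at h

/-- the estimate of the term `I₄`:
`|∫₀ᵇ (N(s(t),ξ;t,0) − N(s̃(t),ξ;t,0)) u₀(ξ) dξ| ≤ C (sup u₀) ‖s − s̃‖_{W^{1,∞}}`. -/
theorem stefan_I4_estimate (b T R : ℝ) (hb : 0 < b) (hT : 0 < T) (hR : 0 < R) :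
    ∃ C > 0, ∀ (u₀ s stil : ℝ → ℝ),
      ContinuousOn u₀ (Icc 0 b) → (∀ x ∈ Icc (0:ℝ) b, 0 ≤ u₀ x) →
      (∃ L : NNReal, LipschitzOnWith L s (Icc 0 T)) →
      (∃ L : NNReal, LipschitzOnWith L stil (Icc 0 T)) →
      s 0 = b → stil 0 = b →
      (∀ t ∈ Icc (0:ℝ) T, 0 < s t) → (∀ t ∈ Icc (0:ℝ) T, 0 < stil t) →
      W1inf T s ≤ R → W1inf T stil ≤ R →
      ∀ t ∈ Ioo (0:ℝ) T,
        |∫ ξ in (0:ℝ)..b, (Nker (s t) ξ t 0 - Nker (stil t) ξ t 0) * u₀ ξ| ≤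
          C * sSup (u₀ '' Icc 0 b) * W1inf T (fun r => s r - stil r) := by
  refine ⟨√8 * √T, by positivity, ?_⟩
  rintro u₀ s stil hu hu0 ⟨L, hs⟩ ⟨L', hs'⟩ hsb hsb' - - - - t ht
  have hbdd : BddAbove (u₀ '' Icc 0 b) := (isCompact_Icc.image_of_continuousOn hu).bddAbove
  have hule : ∀ ξ ∈ Icc 0 b, u₀ ξ ≤ sSup (u₀ '' Icc 0 b) :=
    fun ξ hξ => le_csSup hbdd (mem_image_of_mem _ hξ)
  have h0 : (0:ℝ) ∈ Icc 0 b := left_mem_Icc.2 hb.le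
  have hM : 0 ≤ sSup (u₀ '' Icc 0 b) := (hu0 0 h0).trans (hule 0 h0)
  have hdiff : |s t - stil t| ≤ t * W1inf T (fun r => s r - stil r) :=
    abs_le_mul_W1inf (f := fun r => s r - stil r) (hs.sub hs') (by simp [hsb, hsb'])
      (Ioo_subset_Icc_self ht)
  have hW : 0 ≤ W1inf T (fun r => s r - stil r) :=
    nonneg_of_mul_nonneg_right ((abs_nonneg _).trans hdiff) ht.1
  have hst : 0 < √t := sqrt_pos.2 ht.1
  have hquot : |s t - stil t| / √t ≤ √T * W1inf T (fun r => s r - stil r) := by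
    rw [div_le_iff₀ hst]
    calc |s t - stil t| ≤ √t * √t * W1inf T (fun r => s r - stil r) := by
          rwa [mul_self_sqrt ht.1.le]
      _ ≤ √T * √t * W1inf T (fun r => s r - stil r) := by
          gcongr
          exact ht.2.le
      _ = _ := by ring
  calc _ ≤ √8 * sSup (u₀ '' Icc 0 b) * (|s t - stil t| / √t) :=
        abs_integral_Nker_sub_mul_le hb.le ht.1 hM
          (fun ξ hξ => by rw [abs_of_nonneg (hu0 ξ hξ)]; exact hule ξ hξ) _ _
    _ ≤ √8 * sSup (u₀ '' Icc 0 b) * (√T * W1inf T (fun r => s r - stil r)) := by gcongr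
    _ = _ := by ring
end
end

section
/- For every b > 0, T > 0, M > 0 and R > 0 there exists a constant C > 0 (depending only on b, T, M and R) with the following property: let h̃ ∈ C([0,T]) with sup_{[0,T]} |h̃| ≤ M, and let s, s̃ be continuous functions on [0,T] with s(t) ≥ b and s̃(t) ≥ b on [0,T] and sup_{[0,T]} |s| ≤ R, sup_{[0,T]} |s̃| ≤ R. Then for every t ∈ (0,T): | ∫₀ᵗ (N(s(t),0;t,τ) − N(s̃(t),0;t,τ)) h̃(τ) dτ | ≤ C · sup_{[0,T]} |s − s̃|. -/
open Set MeasureTheory Real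

noncomputable section

lemma Nker_zero (x t τ : ℝ) :
    Nker x 0 t τ = (√(π * (t - τ)))⁻¹ * exp (-(x ^ 2 / (4 * (t - τ)))) := by
  simp only [Nker, Kker, sub_zero, neg_sq, mul_inv, neg_div]
  ring

/-- Lipschitz estimate for Gaussians of variance parameter `r`, away from the origin. -/
lemma exp_neg_sq_div_sub_le {b R r x y : ℝ} (hb : 0 < b) (hr : 0 < r) (hy : b ≤ y)
    (hyx : y ≤ x) (hx : x ≤ R) :
    exp (-(y ^ 2 / (4 * r))) - exp (-(x ^ 2 / (4 * r))) ≤ 16 * R / b ^ 4 * r * (x - y) := by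
  set A := y ^ 2 / (4 * r) with hA
  set B := x ^ 2 / (4 * r) with hB
  have hbA : b ^ 2 / (4 * r) ≤ A := by rw [hA]; gcongr
  have hb0 : 0 < b ^ 2 / (4 * r) := by positivity
  have hdiff : B - A ≤ R * (x - y) / (2 * r) := by
    have : B - A = (x + y) * (x - y) / (4 * r) := by rw [hA, hB]; ring
    rw [this, div_le_div_iff₀ (by positivity) (by positivity)]
    nlinarith [mul_nonneg (mul_nonneg (sub_nonneg.2 hyx) hr.le)
      (by linarith : 0 ≤ 2 * R - (x + y))]
  have hexp : exp (-A) ≤ 32 * r ^ 2 / b ^ 4 := by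
    have h1 := quadratic_le_exp_of_nonneg hb0.le
    have h2 : (b ^ 2 / (4 * r)) ^ 2 / 2 ≤ exp A := by
      have := exp_le_exp.2 hbA
      linarith
    rw [exp_neg]
    refine (inv_anti₀ (by positivity) h2).trans (le_of_eq ?_)
    field_simp
    norm_num
  have hsplit : exp (-A) - exp (-B) ≤ exp (-A) * (B - A) := by
    have h1 : exp (-B) = exp (-A) * exp (-(B - A)) := by rw [← exp_add]; ring_nf
    have h2 := add_one_le_exp (-(B - A))
    rw [h1]
    nlinarith [exp_pos (-A)]
  have hR0 : 0 ≤ R * (x - y) / (2 * r) :=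
    div_nonneg (mul_nonneg (by linarith) (by linarith)) (by positivity)
  calc exp (-A) - exp (-B) ≤ exp (-A) * (B - A) := hsplit
    _ ≤ exp (-A) * (R * (x - y) / (2 * r)) := by gcongr
    _ ≤ 32 * r ^ 2 / b ^ 4 * (R * (x - y) / (2 * r)) := by gcongr
    _ = 16 * R / b ^ 4 * r * (x - y) := by field_simp; ring

lemma abs_Nker_zero_sub_le {b R T t τ x y : ℝ} (hb : 0 < b) (hr : 0 ≤ t - τ)
    (hrT : t - τ ≤ T) (hbx : b ≤ x) (hxR : x ≤ R) (hby : b ≤ y) (hyR : y ≤ R) :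
    |Nker x 0 t τ - Nker y 0 t τ| ≤ 16 * R / b ^ 4 * √T * |x - y| := by
  wlog hyx : y ≤ x generalizing x y
  · rw [abs_sub_comm, abs_sub_comm x y]
    exact this hby hyR hbx hxR (le_of_not_ge hyx)
  have hR : 0 < R := by linarith
  rw [Nker_zero, Nker_zero]
  obtain hr | hr := hr.eq_or_lt
  · rw [← hr]
    simp only [mul_zero, sqrt_zero, inv_zero, zero_mul, sub_zero, abs_zero]
    positivity
  set r := t - τ
  have hmono : exp (-(x ^ 2 / (4 * r))) ≤ exp (-(y ^ 2 / (4 * r))) := by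
    have : 0 ≤ y := by linarith
    gcongr
  have hsqrt : (√(π * r))⁻¹ * r ≤ √T := by
    have h1 : √r ≤ √(π * r) := sqrt_le_sqrt (by nlinarith [pi_gt_three])
    have h2 : 0 < √r := sqrt_pos.2 hr
    calc (√(π * r))⁻¹ * r ≤ (√r)⁻¹ * r := by gcongr
      _ = √r := by rw [inv_mul_eq_div, div_sqrt]
      _ ≤ √T := sqrt_le_sqrt hrT
  rw [← mul_sub, abs_mul, abs_of_nonneg (by positivity : 0 ≤ (√(π * r))⁻¹),
    abs_sub_comm, abs_of_nonneg (sub_nonneg.2 hmono), abs_of_nonneg (sub_nonneg.2 hyx)]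
  have hxy : 0 ≤ x - y := sub_nonneg.2 hyx
  calc _ ≤ (√(π * r))⁻¹ * (16 * R / b ^ 4 * r * (x - y)) := by
        gcongr
        exact exp_neg_sq_div_sub_le hb hr hby hyx hxR
    _ = 16 * R / b ^ 4 * ((√(π * r))⁻¹ * r) * (x - y) := by ring
    _ ≤ 16 * R / b ^ 4 * √T * (x - y) := by gcongr

/-- the estimate of the term `I₁`:
`|∫₀ᵗ (N(s(t),0;t,τ) − N(s̃(t),0;t,τ)) h̃(τ) dτ| ≤ C sup_{[0,T]} |s − s̃|`. -/
theorem stefan_I1_estimate (b T M R : ℝ) (hb : 0 < b) (hT : 0 < T) (hM : 0 < M)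
    (hR : 0 < R) :
    ∃ C > 0, ∀ (htil s stil : ℝ → ℝ),
      ContinuousOn htil (Icc 0 T) → (∀ t ∈ Icc (0:ℝ) T, |htil t| ≤ M) →
      ContinuousOn s (Icc 0 T) → ContinuousOn stil (Icc 0 T) →
      (∀ t ∈ Icc (0:ℝ) T, b ≤ s t) → (∀ t ∈ Icc (0:ℝ) T, b ≤ stil t) →
      (∀ t ∈ Icc (0:ℝ) T, |s t| ≤ R) → (∀ t ∈ Icc (0:ℝ) T, |stil t| ≤ R) →
      ∀ t ∈ Ioo (0:ℝ) T,
        |∫ τ in (0:ℝ)..t, (Nker (s t) 0 t τ - Nker (stil t) 0 t τ) * htil τ| ≤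
          C * sSup ((fun r => |s r - stil r|) '' Icc (0:ℝ) T) := by
  refine ⟨16 * R / b ^ 4 * √T * M * T, by positivity, ?_⟩
  intro htil s stil _ hhM hs hstil hbs hbstil hsR hstilR t ht
  have htI : t ∈ Icc (0 : ℝ) T := Ioo_subset_Icc_self ht
  have hbdd : BddAbove ((fun r => |s r - stil r|) '' Icc (0 : ℝ) T) :=
    isCompact_Icc.bddAbove_image (hs.sub hstil).abs
  have hsup := le_csSup hbdd (mem_image_of_mem _ htI)
  set S := sSup ((fun r => |s r - stil r|) '' Icc (0 : ℝ) T)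
  have hS : 0 ≤ S := (abs_nonneg _).trans hsup
  have hpt : ∀ τ ∈ uIoc 0 t, ‖(Nker (s t) 0 t τ - Nker (stil t) 0 t τ) * htil τ‖ ≤
      16 * R / b ^ 4 * √T * S * M := by
    intro τ hτ
    rw [uIoc_of_le ht.1.le] at hτ
    rw [norm_mul, norm_eq_abs, norm_eq_abs]
    have hker := abs_Nker_zero_sub_le (T := T) hb (sub_nonneg.2 hτ.2)
      (by linarith [hτ.1, ht.2]) (hbs t htI) (le_of_abs_le (hsR t htI)) (hbstil t htI)
      (le_of_abs_le (hstilR t htI))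
    refine mul_le_mul (hker.trans ?_) (hhM τ ⟨hτ.1.le, hτ.2.trans ht.2.le⟩)
      (abs_nonneg _) (by positivity)
    gcongr
  calc _ ≤ 16 * R / b ^ 4 * √T * S * M * |t - 0| :=
        intervalIntegral.norm_integral_le_of_norm_le_const hpt
    _ ≤ 16 * R / b ^ 4 * √T * S * M * T := by
        rw [sub_zero, abs_of_pos ht.1]
        gcongr
        exact ht.2.le
    _ = 16 * R / b ^ 4 * √T * M * T * S := by ring
end
end

section
/- For every T > 0 and M > 0 there exists a constant C > 0 (depending only on T and M) with the following property: let h, h̃ : [0,T] → ℝ be continuous with |h| ≤ M and |h̃| ≤ M, and for x ≥ 0 and t ∈ (0,T) define F(x,t) = (1/√π) ∫₀ᵗ (t−τ)^{−1/2} exp(−x²/(4(t−τ))) (h(τ) − h̃(τ)) dτ. Then |F(x,t) − F(0,t)| ≤ C √x for all x ≥ 0 and t ∈ (0,T). -/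
open Set MeasureTheory Real

noncomputable section

/-- `F(x,t) = (1/√π)∫₀ᵗ (t-τ)^{-1/2} exp(-x²/(4(t-τ)))(h-h̃)(τ) dτ` for real `x ≥ 0`. -/
def Fre (h htil : ℝ → ℝ) (x t : ℝ) : ℝ :=
  (Real.sqrt π)⁻¹ * ∫ τ in (0:ℝ)..t,
    (Real.sqrt (t - τ))⁻¹ * Real.exp (-(x ^ 2) / (4 * (t - τ))) * (h τ - htil τ)

theorem one_sub_exp_neg_le_rpow {a r : ℝ} (ha : 0 ≤ a) (hr₀ : 0 ≤ r) (hr₁ : r ≤ 1) :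
    1 - Real.exp (-a) ≤ a ^ r := by
  rcases le_total a 1 with h | h
  · calc 1 - Real.exp (-a) ≤ a := by linarith [Real.add_one_le_exp (-a)]
      _ ≤ a ^ r := Real.self_le_rpow_of_le_one ha h hr₁
  · linarith [Real.one_le_rpow h hr₀, Real.exp_pos (-a)]

theorem intervalIntegrable_sub_rpow {r : ℝ} (hr : -1 < r) (t : ℝ) :
    IntervalIntegrable (fun τ => (t - τ) ^ r) volume 0 t := by
  simpa using ((intervalIntegral.intervalIntegrable_rpow' (a := 0) (b := t) hr).comp_sub_left
    t).symm

theorem integral_sub_rpow {r : ℝ} (hr : -1 < r) (t : ℝ) :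
    ∫ τ in (0:ℝ)..t, (t - τ) ^ r = t ^ (r + 1) / (r + 1) := by
  rw [intervalIntegral.integral_comp_sub_left (fun s => s ^ r), sub_self, sub_zero,
    integral_rpow (Or.inl hr), Real.zero_rpow (by linarith), sub_zero]

/-- Multiplying a bounded continuous density by the heat factor in `Fre` gives an integrable
function. -/
theorem intervalIntegrable_heat_mul {g : ℝ → ℝ} {t B : ℝ} (ht : 0 ≤ t)
    (hg : ContinuousOn g (Icc 0 t)) (hB : ∀ τ ∈ Icc 0 t, |g τ| ≤ B) (x : ℝ) :
    IntervalIntegrable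
      (fun τ => (Real.sqrt (t - τ))⁻¹ * Real.exp (-(x ^ 2) / (4 * (t - τ))) * g τ)
      volume 0 t := by
  refine ((intervalIntegrable_sub_rpow (r := -(1 / 2)) (by norm_num) t).mul_const B).mono_fun'
    ?_ ?_
  · rw [uIoc_of_le ht]
    refine AEStronglyMeasurable.mul ?_
      ((hg.mono Ioc_subset_Icc_self).aestronglyMeasurable measurableSet_Ioc)
    exact Measurable.aestronglyMeasurable (by fun_prop)
  · rw [uIoc_of_le ht]
    refine (ae_restrict_iff' measurableSet_Ioc).2 (ae_of_all _ fun τ hτ => ?_)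
    have hs : 0 ≤ t - τ := sub_nonneg.2 hτ.2
    have he : Real.exp (-(x ^ 2) / (4 * (t - τ))) ≤ 1 :=
      Real.exp_le_one_iff.2 (div_nonpos_of_nonpos_of_nonneg (by nlinarith [sq_nonneg x])
        (by positivity))
    dsimp only
    rw [Real.norm_eq_abs, abs_mul, Real.rpow_neg hs, ← Real.sqrt_eq_rpow,
      abs_of_nonneg (by positivity)]
    exact mul_le_mul (mul_le_of_le_one_right (by positivity) he) (hB τ (Ioc_subset_Icc_self hτ))
      (abs_nonneg _) (by positivity)

theorem inv_sqrt_mul_one_sub_exp_le {x s : ℝ} (hx : 0 ≤ x) (hs : 0 ≤ s) :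
    (Real.sqrt s)⁻¹ * (1 - Real.exp (-(x ^ 2) / (4 * s))) ≤
      s ^ (-(3 / 4) : ℝ) * Real.sqrt x := by
  rcases hs.eq_or_lt with rfl | hs
  · simp
  have h := one_sub_exp_neg_le_rpow (a := x ^ 2 / (4 * s)) (r := 1 / 4) (by positivity)
    (by norm_num) (by norm_num)
  have h' : (x ^ 2 / (4 * s)) ^ (1 / 4 : ℝ) ≤ s ^ (-(1 / 4) : ℝ) * Real.sqrt x := by
    calc (x ^ 2 / (4 * s)) ^ (1 / 4 : ℝ) ≤ (x ^ 2 / s) ^ (1 / 4 : ℝ) := by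
          gcongr
          linarith
      _ = s ^ (-(1 / 4) : ℝ) * Real.sqrt x := by
          rw [Real.div_rpow (by positivity) hs.le, ← Real.rpow_natCast, ← Real.rpow_mul hx,
            Real.rpow_neg hs.le, Real.sqrt_eq_rpow, div_eq_inv_mul]
          norm_num
  have hsq : (Real.sqrt s)⁻¹ = s ^ (-(1 / 2) : ℝ) := by
    rw [Real.rpow_neg hs.le, Real.sqrt_eq_rpow]
  calc (Real.sqrt s)⁻¹ * (1 - Real.exp (-(x ^ 2) / (4 * s)))
      ≤ s ^ (-(1 / 2) : ℝ) * (s ^ (-(1 / 4) : ℝ) * Real.sqrt x) := by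
        rw [hsq, neg_div]
        gcongr
        exact h.trans h'
    _ = s ^ (-(3 / 4) : ℝ) * Real.sqrt x := by
        rw [← mul_assoc, ← Real.rpow_add hs]
        norm_num

/-- `|F(x,t) − F(0,t)| ≤ C √x` for all `x ≥ 0` and `t ∈ (0,T)`,
with `C` depending only on `T` and `M`. -/
theorem F_holder_at_zero (T M : ℝ) (hT : 0 < T) (hM : 0 < M) :
    ∃ C > 0, ∀ (h htil : ℝ → ℝ),
      ContinuousOn h (Icc 0 T) → ContinuousOn htil (Icc 0 T) →
      (∀ t ∈ Icc (0:ℝ) T, |h t| ≤ M) → (∀ t ∈ Icc (0:ℝ) T, |htil t| ≤ M) →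
      ∀ x : ℝ, 0 ≤ x → ∀ t ∈ Ioo (0:ℝ) T,
        |Fre h htil x t - Fre h htil 0 t| ≤ C * Real.sqrt x := by
  refine ⟨(Real.sqrt π)⁻¹ * (4 * T ^ (1 / 4 : ℝ) * (2 * M)), by positivity, ?_⟩
  intro h htil hc hc' hb hb' x hx t ht
  have hsub : Icc 0 t ⊆ Icc 0 T := Icc_subset_Icc_right ht.2.le
  have hcont : ContinuousOn (fun τ => h τ - htil τ) (Icc 0 t) := (hc.sub hc').mono hsub
  have hbound : ∀ τ ∈ Icc 0 t, |h τ - htil τ| ≤ 2 * M := fun τ hτ =>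
    (abs_sub _ _).trans (by linarith [hb τ (hsub hτ), hb' τ (hsub hτ)])
  have hint := intervalIntegrable_heat_mul ht.1.le hcont hbound
  rw [Fre, Fre, ← mul_sub, ← intervalIntegral.integral_sub (hint x) (hint 0), abs_mul,
    abs_of_nonneg (by positivity : 0 ≤ (Real.sqrt π)⁻¹), mul_assoc]
  refine mul_le_mul_of_nonneg_left ?_ (by positivity)
  rw [← Real.norm_eq_abs]
  calc _ ≤ ∫ τ in (0:ℝ)..t, (t - τ) ^ (-(3 / 4) : ℝ) * (Real.sqrt x * (2 * M)) := by
        refine intervalIntegral.norm_integral_le_of_norm_le ht.1.le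
          (ae_of_all _ fun τ hτ => ?_)
          ((intervalIntegrable_sub_rpow (by norm_num) t).mul_const _)
        have hs : 0 ≤ t - τ := sub_nonneg.2 hτ.2
        have he : Real.exp (-(x ^ 2) / (4 * (t - τ))) ≤ 1 :=
          Real.exp_le_one_iff.2 (div_nonpos_of_nonpos_of_nonneg (by nlinarith [sq_nonneg x])
            (by positivity))
        have hfac : (Real.sqrt (t - τ))⁻¹ * Real.exp (-(x ^ 2) / (4 * (t - τ))) *
              (h τ - htil τ) -
            (Real.sqrt (t - τ))⁻¹ * Real.exp (-(0 ^ 2) / (4 * (t - τ))) * (h τ - htil τ) =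
            -((Real.sqrt (t - τ))⁻¹ * (1 - Real.exp (-(x ^ 2) / (4 * (t - τ)))) *
              (h τ - htil τ)) := by
          simp only [ne_eq, OfNat.ofNat_ne_zero, not_false_eq_true, zero_pow, neg_zero,
            zero_div, Real.exp_zero]
          ring
        rw [hfac, norm_neg, Real.norm_eq_abs, abs_mul, ← mul_assoc,
          abs_of_nonneg (mul_nonneg (by positivity) (sub_nonneg.2 he))]
        exact mul_le_mul (inv_sqrt_mul_one_sub_exp_le hx hs)
          (hbound τ (Ioc_subset_Icc_self hτ)) (abs_nonneg _) (by positivity)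
    _ = 4 * t ^ (1 / 4 : ℝ) * (2 * M) * Real.sqrt x := by
        rw [intervalIntegral.integral_mul_const, integral_sub_rpow (by norm_num)]
        norm_num
        ring
    _ ≤ 4 * T ^ (1 / 4 : ℝ) * (2 * M) * Real.sqrt x := by
        have := ht.1.le
        gcongr
        exact ht.2.le
    _ = _ := by ring
end
end
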